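/- (Central limit theorem and law of the iterated logarithm for martingales under a drift function.) Let u be a drift function, α ∈ ℝ₊*, g ∈ 𝓔^{2+α}_u and x ∈ 𝐗 with u(x) < ∞. Assume that (1/n)·Σ_{k=0}^{n−1} (P(g²)(X_k) − (Pg(X_k))²) converges, ℙ_x-almost everywhere and in L¹(ℙ_x), to a constant σ²(g,x) ≠ 0. Then (1/√n)·Σ_{k=0}^{n−1} (g(X_{k+1}) − Pg(X_k)) converges in law (under ℙ_x) to the Gaussian distribution 𝓝(0, σ²(g,x)); moreover, ℙ_x-almost surely, limsup_n Σ_{k=0}^{n−1}(g(X_{k+1}) − Pg(X_k)) / √(2n·σ²(g,x)·lnln n) = 1 and liminf_n Σ_{k=0}^{n−1}(g(X_{k+1}) − Pg(X_k)) / √(2n·σ²(g,x)·lnln n) = −1. -/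

import Mathlib

open MeasureTheory Filter Set Topology
open scoped ENNReal NNReal ENat

noncomputable section

/-- The shift on path space. -/
def pshift {X : Type*} (ω : ℕ → X) : ℕ → X := fun n => ω (n + 1)

/-- The natural filtration on path space: the σ-algebra generated by the first `n+1`
coordinates. -/
def pathFiltration (X : Type*) [MeasurableSpace X] (n : ℕ) : MeasurableSpace (ℕ → X) :=
  MeasurableSpace.comap (fun ω (i : Fin (n + 1)) => ω (i : ℕ)) inferInstance

/-- A Markov chain on `X`, given by the family of its path-space laws `ℙ_x`. -/
structure MarkovChain (X : Type*) [MeasurableSpace X] where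
  law : X → Measure (ℕ → X)
  prob : ∀ x, IsProbabilityMeasure (law x)
  meas_law : Measurable law
  start : ∀ x, (law x).map (fun ω => ω 0) = Measure.dirac x
  markov : ∀ (x : X) (n : ℕ) (A : Set (ℕ → X)),
      MeasurableSet[pathFiltration X n] A → ∀ g : (ℕ → X) → ℝ≥0∞, Measurable g →
      ∫⁻ ω in A, g (fun k => ω (k + n)) ∂law x = ∫⁻ ω in A, ∫⁻ η, g η ∂law (ω n) ∂law x

variable {X : Type*} [MeasurableSpace X]

/-- A stopping time on path space, with values in `ℕ∞`. -/
def IsPathStoppingTime (τ : (ℕ → X) → ℕ∞) : Prop :=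
  ∀ n : ℕ, MeasurableSet[pathFiltration X n] {ω | τ ω = (n : ℕ∞)}

/-- `τ` is θ-compatible: `ℙ_x(τ = 0) = 0` and, almost everywhere, `τ ≥ 2` implies
`τ ∘ θ = τ - 1`. -/
def ThetaCompatible (M : MarkovChain X) (τ : (ℕ → X) → ℕ∞) : Prop :=
  (∀ x, M.law x {ω | τ ω = 0} = 0) ∧
    ∀ x, ∀ᵐ ω ∂M.law x, 2 ≤ τ ω → τ (pshift ω) = τ ω - 1

/-- The Markov operator `P` on nonnegative functions: `Pf(x) = 𝔼_x f(X_1)`. -/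
def Pop (M : MarkovChain X) (f : X → ℝ≥0∞) (x : X) : ℝ≥0∞ := ∫⁻ ω, f (ω 1) ∂M.law x

/-- The induced operator `Q`: `Qg(x) = ∫_{τ<∞} g(X_τ) dℙ_x`. -/
def Qop (M : MarkovChain X) (τ : (ℕ → X) → ℕ∞) (g : X → ℝ≥0∞) (x : X) : ℝ≥0∞ :=
  ∫⁻ ω in {ω | τ ω ≠ ⊤}, g (ω (τ ω).toNat) ∂M.law x

/-- The operator `S`: `Sf(x) = ∫_{τ=1} f(X_1) dℙ_x`. -/
def Sop (M : MarkovChain X) (τ : (ℕ → X) → ℕ∞) (f : X → ℝ≥0∞) (x : X) : ℝ≥0∞ :=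
  ∫⁻ ω in {ω | τ ω = 1}, f (ω 1) ∂M.law x

/-- The operator `R`: `Rf(x) = ∫_{τ<∞} (f(X_0) + ⋯ + f(X_{τ-1})) dℙ_x`. -/
def Rop (M : MarkovChain X) (τ : (ℕ → X) → ℕ∞) (f : X → ℝ≥0∞) (x : X) : ℝ≥0∞ :=
  ∫⁻ ω in {ω | τ ω ≠ ⊤}, ∑ k ∈ Finset.range (τ ω).toNat, f (ω k) ∂M.law x

/-- `𝔼_x τ`, with values in `[0,∞]`. -/
def EtauE (M : MarkovChain X) (τ : (ℕ → X) → ℕ∞) (x : X) : ℝ≥0∞ :=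
  ∫⁻ ω, (τ ω : ℝ≥0∞) ∂M.law x

/-- `μ` is `P`-invariant: `∫ Pf dμ = ∫ f dμ` for every bounded nonnegative borelian `f`. -/
def PInvariant (M : MarkovChain X) (μ : Measure X) : Prop :=
  ∀ f : X → ℝ≥0∞, Measurable f → (∃ C : ℝ≥0∞, C ≠ ⊤ ∧ ∀ x, f x ≤ C) →
    ∫⁻ x, Pop M f x ∂μ = ∫⁻ x, f x ∂μ

/-- `ν` is `Q`-invariant: `∫ Qf dν = ∫ f dν` for every bounded nonnegative borelian `f`. -/
def QInvariant (M : MarkovChain X) (τ : (ℕ → X) → ℕ∞) (ν : Measure X) : Prop :=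
  ∀ f : X → ℝ≥0∞, Measurable f → (∃ C : ℝ≥0∞, C ≠ ⊤ ∧ ∀ x, f x ≤ C) →
    ∫⁻ x, Qop M τ f x ∂ν = ∫⁻ x, f x ∂ν

/-- `ν = S*μ`, i.e. `ν(A) = ∫ S𝟙_A dμ` for every borelian `A`. -/
def SstarEq (M : MarkovChain X) (τ : (ℕ → X) → ℕ∞) (μ ν : Measure X) : Prop :=
  ∀ A : Set X, MeasurableSet A → ν A = ∫⁻ x, Sop M τ (A.indicator 1) x ∂μ

/-- `m = R*ν`, i.e. `m(A) = ∫ R𝟙_A dν` for every borelian `A`. -/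
def RstarEq (M : MarkovChain X) (τ : (ℕ → X) → ℕ∞) (ν m : Measure X) : Prop :=
  ∀ A : Set X, MeasurableSet A → m A = ∫⁻ x, Rop M τ (A.indicator 1) x ∂ν

/-- the real-valued Markov operator -/
def Pr (M : MarkovChain X) (f : X → ℝ) (x : X) : ℝ := ∫ ω, f (ω 1) ∂M.law x

/-- the real-valued induced operator -/
def Qr (M : MarkovChain X) (τ : (ℕ → X) → ℕ∞) (g : X → ℝ) (x : X) : ℝ :=
  ∫ ω in {ω | τ ω ≠ ⊤}, g (ω (τ ω).toNat) ∂M.law x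

/-- the real-valued operator `S` -/
def Sr (M : MarkovChain X) (τ : (ℕ → X) → ℕ∞) (f : X → ℝ) (x : X) : ℝ :=
  ∫ ω in {ω | τ ω = 1}, f (ω 1) ∂M.law x

/-- the real-valued operator `R` -/
def Rr (M : MarkovChain X) (τ : (ℕ → X) → ℕ∞) (f : X → ℝ) (x : X) : ℝ :=
  ∫ ω in {ω | τ ω ≠ ⊤}, ∑ k ∈ Finset.range (τ ω).toNat, f (ω k) ∂M.law x

/-- `𝔼_x τ` as a real number. -/
def Etau (M : MarkovChain X) (τ : (ℕ → X) → ℕ∞) (x : X) : ℝ := (EtauE M τ x).toReal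

/-- `B_u = sup (Pu - u) + 1`. -/
def Bu (M : MarkovChain X) (u : X → ℝ) : ℝ :=
  sSup (Set.range fun x => Pr M u x - u x) + 1

/-- the weight `u - Pu + B_u` defining the space `𝓔_u`. -/
def wE (M : MarkovChain X) (u : X → ℝ) : X → ℝ := fun x => u x - Pr M u x + Bu M u

/-- `u` is a drift function: `u ≥ 1`, `u - Pu` is bounded below and, with
`B_u = sup (Pu - u) + 1`, the functions `Qu`, `𝔼τ/u` and `P(u-Pu+B_u)/(u-Pu+B_u)` are
bounded. -/
structure IsDrift (M : MarkovChain X) (τ : (ℕ → X) → ℕ∞) (u : X → ℝ) : Prop where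
  meas : Measurable u
  one_le : ∀ x, 1 ≤ u x
  int_one : ∀ x, Integrable (fun ω => u (ω 1)) (M.law x)
  bdd : BddAbove (Set.range fun x => Pr M u x - u x)
  etau_ne_top : ∀ x, EtauE M τ x ≠ ⊤
  qu_bdd : ∃ C : ℝ, ∀ x, Qr M τ u x ≤ C
  etau_div_bdd : ∃ C : ℝ, ∀ x, Etau M τ x ≤ C * u x
  pw_bdd : ∃ C : ℝ, ∀ x, Pr M (wE M u) x ≤ C * wE M u x

/-- membership in the weighted space `𝓕^p_v` : `f` is borelian and `|f| ≤ C v^{1/p}`. -/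
def MemWp (v : X → ℝ) (p : ℝ) (f : X → ℝ) : Prop :=
  Measurable f ∧ ∃ C : ℝ, ∀ x, |f x| ≤ C * v x ^ (1 / p)

/-- the norm of the weighted space `𝓕^p_v` : `‖f‖ = sup_x |f(x)|/v(x)^{1/p}`. -/
def normWp (v : X → ℝ) (p : ℝ) (f : X → ℝ) : ℝ := ⨆ x, |f x| / v x ^ (1 / p)

/-- ergodicity among a class of invariant measures: a finite nonzero invariant measure is
ergodic if it is not a nontrivial convex combination of two distinct invariant probability
measures. -/
def ErgodicAmong (Inv : Measure X → Prop) (μ : Measure X) : Prop :=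
  μ ≠ 0 ∧ ∀ (ν₁ ν₂ : Measure X) (t : ℝ≥0∞), Inv ν₁ → Inv ν₂ →
    IsProbabilityMeasure ν₁ → IsProbabilityMeasure ν₂ → 0 < t → t < 1 →
    μ = μ Set.univ • (t • ν₁ + (1 - t) • ν₂) → ν₁ = ν₂


set_option linter.unusedSectionVars false

set_option linter.unusedSectionVars false
/-- Bounded martingale differences `D` with conditional variances `v`. -/
structure BMD {Ω : Type*} {m0 : MeasurableSpace Ω} (μ : Measure Ω) (ℱ : Filtration ℕ m0)
    (D v : ℕ → Ω → ℝ) (B : ℕ → ℝ) : Prop where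
  hD : ∀ k, StronglyMeasurable[ℱ (k+1)] (D k)
  hv : ∀ k, StronglyMeasurable[ℱ k] (v k)
  bdd : ∀ k, ∀ᵐ ω ∂μ, |D k ω| ≤ B k
  mean : ∀ k, μ[D k | ℱ k] =ᵐ[μ] 0
  var : ∀ k, μ[fun ω => D k ω ^ 2 | ℱ k] =ᵐ[μ] v k

namespace BMD

variable {Ω : Type*} {m0 : MeasurableSpace Ω} {μ : Measure Ω} [IsProbabilityMeasure μ]
  {ℱ : Filtration ℕ m0} {D v : ℕ → Ω → ℝ} {B : ℕ → ℝ}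

lemma intD (h : BMD μ ℱ D v B) (k : ℕ) : Integrable (D k) μ :=
  Integrable.of_bound ((h.hD k).mono (ℱ.le _)).aestronglyMeasurable (B k) (h.bdd k)

lemma intD2 (h : BMD μ ℱ D v B) (k : ℕ) : Integrable (fun ω => D k ω ^ 2) μ := by
  refine Integrable.of_bound (((h.hD k).mono (ℱ.le _)).pow 2).aestronglyMeasurable (B k ^ 2) ?_
  filter_upwards [h.bdd k] with ω hω
  rw [Real.norm_eq_abs, abs_pow]
  exact pow_le_pow_left₀ (abs_nonneg _) hω 2

lemma vnn (h : BMD μ ℱ D v B) (k : ℕ) : ∀ᵐ ω ∂μ, 0 ≤ v k ω := by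
  have : 0 ≤ᵐ[μ] μ[fun ω => D k ω ^ 2 | ℱ k] :=
    condExp_nonneg (ae_of_all _ fun ω => sq_nonneg _)
  filter_upwards [this, h.var k] with ω h1 h2
  rw [← h2]; exact h1

lemma vle (h : BMD μ ℱ D v B) (k : ℕ) : ∀ᵐ ω ∂μ, v k ω ≤ B k ^ 2 := by
  have : μ[fun ω => D k ω ^ 2 | ℱ k] ≤ᵐ[μ] μ[fun _ => B k ^ 2 | ℱ k] := by
    refine condExp_mono (h.intD2 k) (integrable_const _) ?_
    filter_upwards [h.bdd k] with ω hω
    rw [← sq_abs]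
    exact pow_le_pow_left₀ (abs_nonneg _) hω 2
  rw [condExp_const (ℱ.le k)] at this
  filter_upwards [this, h.var k] with ω h1 h2
  rw [← h2]; exact h1

lemma condQuad (h : BMD μ ℱ D v B) (k : ℕ) (a b c : ℝ) :
    μ[fun ω => a + b * D k ω + c * D k ω ^ 2 | ℱ k] =ᵐ[μ] fun ω => a + c * v k ω := by
  have e : (fun ω => a + b * D k ω + c * D k ω ^ 2)
      = ((fun _ => a) + b • D k) + c • (fun ω => D k ω ^ 2) := by
    ext ω; simp
  rw [e]
  have h1 := condExp_add (m := ℱ k) ((integrable_const a).add ((h.intD k).smul b))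
    ((h.intD2 k).smul c)
  have h2 := condExp_add (m := ℱ k) (integrable_const (μ := μ) a) ((h.intD k).smul b)
  have h3 := condExp_smul (μ := μ) b (D k) (ℱ k)
  have h4 := condExp_smul (μ := μ) c (fun ω => D k ω ^ 2) (ℱ k)
  filter_upwards [h1, h2, h3, h4, h.mean k, h.var k] with ω h1 h2 h3 h4 h5 h6
  rw [h1, Pi.add_apply, h2, Pi.add_apply, h3, h4, Pi.smul_apply, Pi.smul_apply, h5, h6,
    condExp_const (ℱ.le k)]
  simp

lemma exp_quad {η y : ℝ} (h1 : η ≤ 1) (hy : |y| ≤ η) :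
    |Real.exp y - (1 + y + y ^ 2 / 2)| ≤ 2 / 9 * η * y ^ 2 := by
  have := Real.exp_bound (hy.trans h1) (n := 3) (by norm_num)
  simp only [Finset.sum_range_succ, Finset.sum_range_zero] at this
  norm_num [Nat.factorial] at this
  refine this.trans ?_
  have e : |y| ^ 3 = |y| * y ^ 2 := by rw [← sq_abs y]; ring
  rw [e]
  nlinarith [sq_nonneg y]

lemma intExp (h : BMD μ ℱ D v B) (k : ℕ) (l : ℝ) :
    Integrable (fun ω => Real.exp (l * D k ω)) μ := by
  refine Integrable.of_bound (C := Real.exp (|l| * B k)) ?_ ?_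
  · exact (Real.continuous_exp.comp_stronglyMeasurable
      (((h.hD k).mono (ℱ.le _)).const_mul l)).aestronglyMeasurable
  · filter_upwards [h.bdd k] with ω hω
    rw [Real.norm_eq_abs, Real.abs_exp]
    refine Real.exp_le_exp.2 ?_
    calc l * D k ω ≤ |l * D k ω| := le_abs_self _
      _ = |l| * |D k ω| := abs_mul _ _
      _ ≤ _ := by gcongr

lemma exp_upper (h : BMD μ ℱ D v B) (k : ℕ) {l η : ℝ} (h1 : η ≤ 1) (hl : |l| * B k ≤ η) :
    μ[fun ω => Real.exp (l * D k ω) | ℱ k] ≤ᵐ[μ] fun ω => Real.exp ((1 + η) * l ^ 2 * v k ω / 2) := by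
  have hm : μ[fun ω => Real.exp (l * D k ω) | ℱ k] ≤ᵐ[μ]
      μ[fun ω => 1 + l * D k ω + ((1 + η) * l ^ 2 / 2) * D k ω ^ 2 | ℱ k] := by
    refine condExp_mono (h.intExp k l)
      (((integrable_const _).add ((h.intD k).const_mul _)).add ((h.intD2 k).const_mul _)) ?_
    filter_upwards [h.bdd k] with ω hω
    have hy : |l * D k ω| ≤ η := by
      rw [abs_mul]; exact le_trans (by gcongr) hl
    have := (abs_le.1 (exp_quad h1 hy)).2
    have hη : 0 ≤ η := (abs_nonneg _).trans hy
    nlinarith [mul_nonneg hη (sq_nonneg (l * D k ω))]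
  filter_upwards [hm, h.condQuad k 1 l ((1 + η) * l ^ 2 / 2)] with ω h2 h3
  rw [h3] at h2
  refine h2.trans ?_
  have := Real.add_one_le_exp ((1 + η) * l ^ 2 * v k ω / 2)
  linarith

lemma exp_lower (h : BMD μ ℱ D v B) (k : ℕ) {l η : ℝ} (h1 : η ≤ 1) (hl : |l| * B k ≤ η) :
    (fun ω => Real.exp ((1 - η) * l ^ 2 * v k ω / 2)) ≤ᵐ[μ] μ[fun ω => Real.exp (l * D k ω) | ℱ k] := by
  have hm : μ[fun ω => 1 + l * D k ω + ((1 - 4 / 9 * η) * l ^ 2 / 2) * D k ω ^ 2 | ℱ k] ≤ᵐ[μ]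
      μ[fun ω => Real.exp (l * D k ω) | ℱ k] := by
    refine condExp_mono
      (((integrable_const _).add ((h.intD k).const_mul _)).add ((h.intD2 k).const_mul _))
      (h.intExp k l) ?_
    filter_upwards [h.bdd k] with ω hω
    have hy : |l * D k ω| ≤ η := by
      rw [abs_mul]; exact le_trans (by gcongr) hl
    have := (abs_le.1 (exp_quad h1 hy)).1
    nlinarith
  filter_upwards [hm, h.condQuad k 1 l ((1 - 4 / 9 * η) * l ^ 2 / 2), h.vnn k, h.vle k, h.bdd k]
    with ω h2 h3 h4 h5 h6
  rw [h3] at h2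
  refine le_trans ?_ h2
  have hB : 0 ≤ B k := (abs_nonneg _).trans h6
  have hη : 0 ≤ η := le_trans (by positivity) hl
  set z := l ^ 2 * v k ω / 2 with hz
  have hz0 : 0 ≤ z := by positivity
  have hz1 : z ≤ η ^ 2 / 2 := by
    have : l ^ 2 * v k ω ≤ (|l| * B k) ^ 2 := by
      rw [mul_pow, sq_abs]; gcongr
    have : (|l| * B k) ^ 2 ≤ η ^ 2 := by gcongr
    rw [hz]; linarith
  have hz2 : z ≤ 1 / 2 * η := by nlinarith
  have e1 : (1 - η) * l ^ 2 * v k ω / 2 = (1 - η) * z := by rw [hz]; ring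
  have e2 : 1 + (1 - 4 / 9 * η) * l ^ 2 / 2 * v k ω = 1 + (1 - 4 / 9 * η) * z := by rw [hz]; ring
  rw [e1, e2]
  have hy0 : 0 ≤ (1 - η) * z := mul_nonneg (by linarith) hz0
  have hy1 : |(1 - η) * z| ≤ 1 := by
    rw [abs_of_nonneg hy0]; nlinarith
  have := (abs_le.1 (Real.abs_exp_sub_one_sub_id_le hy1)).2
  have h7 : ((1 - η) * z) ^ 2 ≤ z * (1 / 2 * η) := by
    have : ((1 - η) * z) ≤ z := by nlinarith
    have h8 : ((1 - η) * z) ^ 2 ≤ z ^ 2 := by gcongr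
    nlinarith
  nlinarith [mul_nonneg hη hz0]

/-- the exponential process -/
def EP (D v : ℕ → Ω → ℝ) (l : ℕ → ℝ) (s : ℝ) (n : ℕ) (ω : Ω) : ℝ :=
  Real.exp (∑ k ∈ Finset.range n, (l k * D k ω - s * l k ^ 2 * v k ω / 2))

lemma EP_pos (D v : ℕ → Ω → ℝ) (l : ℕ → ℝ) (s : ℝ) (n : ℕ) (ω : Ω) : 0 < EP D v l s n ω :=
  Real.exp_pos _

lemma EP_succ (D v : ℕ → Ω → ℝ) (l : ℕ → ℝ) (s : ℝ) (n : ℕ) :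
    EP D v l s (n + 1) = (fun ω => EP D v l s n ω * Real.exp (-(s * l n ^ 2 * v n ω / 2))) *
      (fun ω => Real.exp (l n * D n ω)) := by
  ext ω
  simp only [EP, Pi.mul_apply, Finset.sum_range_succ, ← Real.exp_add]
  congr 1; ring

lemma EP_meas (h : BMD μ ℱ D v B) (l : ℕ → ℝ) (s : ℝ) : StronglyAdapted ℱ (EP D v l s) := by
  intro n
  refine Real.continuous_exp.comp_stronglyMeasurable ?_
  refine Finset.stronglyMeasurable_fun_sum _ fun k hk => ?_
  have hk' := Finset.mem_range.1 hk
  have a1 := ((h.hD k).mono (ℱ.mono hk')).const_mul (l k)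
  have a2 := ((h.hv k).mono (ℱ.mono hk'.le)).const_mul (s * l k ^ 2)
  exact a1.sub (a2.mul stronglyMeasurable_const)

lemma EP_int (h : BMD μ ℱ D v B) (l : ℕ → ℝ) (s : ℝ) (n : ℕ) : Integrable (EP D v l s n) μ := by
  refine Integrable.of_bound (C := Real.exp (∑ k ∈ Finset.range n, (|l k| * B k + |s| * l k ^ 2 * B k ^ 2 / 2)))
    ((h.EP_meas l s n).mono (ℱ.le _)).aestronglyMeasurable ?_
  filter_upwards [ae_all_iff.2 h.bdd, ae_all_iff.2 h.vnn, ae_all_iff.2 h.vle] with ω h1 h2 h3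
  rw [EP, Real.norm_eq_abs, Real.abs_exp]
  gcongr with k hk
  have : l k * D k ω ≤ |l k| * B k :=
    (le_abs_self _).trans (by rw [abs_mul]; gcongr; exact h1 k)
  have : -(s * l k ^ 2 * v k ω / 2) ≤ |s| * l k ^ 2 * B k ^ 2 / 2 := by
    refine (neg_le_abs _).trans ?_
    rw [abs_div, abs_mul, abs_mul, abs_of_nonneg (h2 k), abs_of_nonneg (sq_nonneg (l k)), abs_two]
    gcongr; exact h3 k
  linarith

lemma EP_cond (h : BMD μ ℱ D v B) (l : ℕ → ℝ) (s : ℝ) (n : ℕ) :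
    μ[EP D v l s (n + 1) | ℱ n] =ᵐ[μ] (fun ω => EP D v l s n ω * Real.exp (-(s * l n ^ 2 * v n ω / 2)))
      * μ[fun ω => Real.exp (l n * D n ω) | ℱ n] := by
  have hi := h.EP_int l s (n + 1)
  rw [EP_succ] at hi ⊢
  refine condExp_mul_of_stronglyMeasurable_left ?_ hi (h.intExp n (l n))
  refine (h.EP_meas l s n).mul (Real.continuous_exp.comp_stronglyMeasurable ?_)
  exact (((h.hv n).const_mul (s * l n ^ 2)).mul stronglyMeasurable_const).neg

lemma EP_super (h : BMD μ ℱ D v B) (l : ℕ → ℝ) {η : ℝ} (h1 : η ≤ 1) (hl : ∀ k, |l k| * B k ≤ η) :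
    Supermartingale (EP D v l (1 + η)) ℱ μ := by
  refine supermartingale_nat (h.EP_meas l _) (h.EP_int l _) fun n => ?_
  filter_upwards [h.EP_cond l (1 + η) n, h.exp_upper n h1 (hl n)] with ω h2 h3
  rw [h2, Pi.mul_apply]
  have h4 := EP_pos D v l (1 + η) n ω
  calc _ ≤ EP D v l (1 + η) n ω * Real.exp (-((1 + η) * l n ^ 2 * v n ω / 2)) *
        Real.exp ((1 + η) * l n ^ 2 * v n ω / 2) := by gcongr
    _ = _ := by rw [mul_assoc, ← Real.exp_add]; simp

lemma EP_sub (h : BMD μ ℱ D v B) (l : ℕ → ℝ) {η s : ℝ} (h1 : η ≤ 1) (hl : ∀ k, |l k| * B k ≤ η)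
    (hs : s ≤ 1 - η) :
    Submartingale (EP D v l s) ℱ μ := by
  refine submartingale_nat (h.EP_meas l _) (h.EP_int l _) fun n => ?_
  filter_upwards [h.EP_cond l s n, h.exp_lower n h1 (hl n), h.vnn n] with ω h2 h3 h5
  rw [h2, Pi.mul_apply]
  have h4 := EP_pos D v l s n ω
  calc EP D v l s n ω = EP D v l s n ω * Real.exp (-(s * l n ^ 2 * v n ω / 2)) *
        Real.exp (s * l n ^ 2 * v n ω / 2) := by rw [mul_assoc, ← Real.exp_add]; simp
    _ ≤ EP D v l s n ω * Real.exp (-(s * l n ^ 2 * v n ω / 2)) *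
        Real.exp ((1 - η) * l n ^ 2 * v n ω / 2) := by gcongr
    _ ≤ _ := by gcongr

lemma neg (h : BMD μ ℱ D v B) : BMD μ ℱ (fun k ω => - D k ω) v B where
  hD k := (h.hD k).neg
  hv := h.hv
  bdd k := by simpa using h.bdd k
  mean k := by
    have := condExp_neg (μ := μ) (D k) (ℱ k)
    filter_upwards [this, h.mean k] with ω h1 h2
    have h3 : (fun ω => - D k ω) = - D k := rfl
    rw [h3, h1, Pi.neg_apply, h2]; simp
  var k := by simpa using h.var k

end BMD

/-- the LIL normalization -/
def LL (x : ℝ) : ℝ := Real.sqrt (2 * x * Real.log (Real.log x))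

lemma LL_nonneg (x : ℝ) : 0 ≤ LL x := Real.sqrt_nonneg _

lemma LL_mono {x y : ℝ} (hx : Real.exp 1 ≤ x) (hxy : x ≤ y) : LL x ≤ LL y := by
  have h0 : 0 < x := (Real.exp_pos 1).trans_le hx
  have h1 : 1 ≤ Real.log x := (Real.le_log_iff_exp_le h0).2 hx
  have h2 : Real.log x ≤ Real.log y := Real.log_le_log h0 hxy
  have h3 : 0 ≤ Real.log (Real.log x) := Real.log_nonneg h1
  have h4 : Real.log (Real.log x) ≤ Real.log (Real.log y) := Real.log_le_log (by linarith) h2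
  unfold LL
  refine Real.sqrt_le_sqrt ?_
  gcongr
  linarith

lemma LL_small {β : ℝ} (hβ : β < 1 / 2) :
    Tendsto (fun x : ℝ => LL x * x ^ (β - 1)) atTop (𝓝 0) := by
  set s := 1 / 2 - β with hs
  have hs0 : 0 < s := by linarith
  have hlim : Tendsto (fun x : ℝ => Real.sqrt (2 / s) * x ^ (-(s / 2))) atTop (𝓝 0) := by
    simpa using (tendsto_rpow_neg_atTop (by positivity : 0 < s / 2)).const_mul (Real.sqrt (2 / s))
  refine squeeze_zero' ?_ ?_ hlim
  · filter_upwards [eventually_ge_atTop 0] with x hx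
    exact mul_nonneg (LL_nonneg x) (Real.rpow_nonneg hx _)
  · filter_upwards [eventually_ge_atTop (Real.exp 1)] with x hx
    have h0 : 0 < x := (Real.exp_pos 1).trans_le hx
    have h1 : 1 ≤ Real.log x := (Real.le_log_iff_exp_le h0).2 hx
    have h2 : Real.log (Real.log x) ≤ Real.log x - 1 := Real.log_le_sub_one_of_pos (by linarith)
    have h3 : Real.log x ≤ x ^ s / s := Real.log_le_rpow_div h0.le hs0
    have h4 : LL x ≤ Real.sqrt (2 / s) * x ^ ((1 + s) / 2) := by
      unfold LL
      have : Real.sqrt (2 / s) * x ^ ((1 + s) / 2) = Real.sqrt (2 / s * x ^ (1 + s)) := by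
        rw [Real.sqrt_mul (by positivity), Real.sqrt_eq_rpow (x ^ (1 + s)), ← Real.rpow_mul h0.le]
        ring_nf
      rw [this]
      refine Real.sqrt_le_sqrt ?_
      rw [Real.rpow_add h0, Real.rpow_one]
      calc 2 * x * Real.log (Real.log x) ≤ 2 * x * (x ^ s / s) := by gcongr; linarith
        _ = _ := by ring
    calc LL x * x ^ (β - 1) ≤ Real.sqrt (2 / s) * x ^ ((1 + s) / 2) * x ^ (β - 1) := by gcongr
      _ = Real.sqrt (2 / s) * x ^ (-(s / 2)) := by
        rw [mul_assoc, ← Real.rpow_add h0]; congr 2; rw [hs]; ring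

namespace BMD

variable {Ω : Type*} {m0 : MeasurableSpace Ω} {μ : Measure Ω} [IsProbabilityMeasure μ]
  {ℱ : Filtration ℕ m0} {D v : ℕ → Ω → ℝ} {B : ℕ → ℝ}

lemma maxBound (h : BMD μ ℱ D v B) {N : ℕ} {lam η Y : ℝ} (hlam : 0 < lam) (hη : 0 ≤ η) (h1 : η ≤ 1)
    (hB : ∀ k < N, lam * B k ≤ η) (hV : ∀ᵐ ω ∂μ, ∑ k ∈ Finset.range N, v k ω ≤ Y) (a : ℝ) :
    μ {ω | ∃ n ≤ N, a ≤ ∑ k ∈ Finset.range n, D k ω}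
      ≤ ENNReal.ofReal (Real.exp (-lam * a + (1 + η) * lam ^ 2 * Y / 2)) := by
  set l : ℕ → ℝ := fun k => if k < N then lam else 0 with hl
  have hlB : ∀ k, |l k| * B k ≤ η := by
    intro k
    by_cases hk : k < N
    · simp only [hl, hk, if_true, abs_of_pos hlam]; exact hB k hk
    · simp [hl, hk, hη]
  have hsub := h.EP_sub l h1 hlB (s := 0) (by linarith)
  have hsup := h.EP_super l h1 hlB
  have hexp : ∀ n ≤ N, ∀ ω, EP D v l 0 n ω = Real.exp (lam * ∑ k ∈ Finset.range n, D k ω) := by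
    intro n hn ω
    simp only [EP]
    rw [Finset.mul_sum]
    congr 1
    refine Finset.sum_congr rfl fun k hk => ?_
    have : k < N := (Finset.mem_range.1 hk).trans_le hn
    simp [hl, this]
  have hitg : ∫ ω, EP D v l 0 N ω ∂μ ≤ Real.exp ((1 + η) * lam ^ 2 * Y / 2) := by
    have e1 : ∫ ω, EP D v l (1 + η) N ω ∂μ ≤ 1 := by
      have := hsup.setIntegral_le (Nat.zero_le N) (MeasurableSet.univ (m := ℱ 0) )
      simpa [EP] using this
    have e2 : ∫ ω, EP D v l 0 N ω ∂μ ≤ ∫ ω, Real.exp ((1 + η) * lam ^ 2 * Y / 2) * EP D v l (1 + η) N ω ∂μ := by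
      refine integral_mono_ae (h.EP_int _ _ _) ((h.EP_int _ _ _).const_mul _) ?_
      filter_upwards [hV] with ω hω
      simp only [EP]
      rw [← Real.exp_add]
      refine Real.exp_le_exp.2 ?_
      rw [Finset.sum_sub_distrib, Finset.sum_sub_distrib]
      have : ∑ k ∈ Finset.range N, (1 + η) * l k ^ 2 * v k ω / 2
          = (1 + η) * lam ^ 2 / 2 * ∑ k ∈ Finset.range N, v k ω := by
        rw [Finset.mul_sum]
        refine Finset.sum_congr rfl fun k hk => ?_
        simp only [hl, Finset.mem_range.1 hk, if_true]; ring
      rw [this]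
      have : (1 + η) * lam ^ 2 / 2 * ∑ k ∈ Finset.range N, v k ω ≤ (1 + η) * lam ^ 2 / 2 * Y := by
        gcongr
      simp only [zero_mul, zero_div, Finset.sum_const_zero]
      linarith
    rw [integral_const_mul] at e2
    refine e2.trans ?_
    have := Real.exp_pos ((1 + η) * lam ^ 2 * Y / 2)
    nlinarith
  have hmax := maximal_ineq hsub (fun n ω => (EP_pos D v l 0 n ω).le)
    (ε := (Real.exp (lam * a)).toNNReal) N
  set A := {ω | ((Real.exp (lam * a)).toNNReal : ℝ) ≤
    (Finset.range (N + 1)).sup' Finset.nonempty_range_add_one fun k => EP D v l 0 k ω} with hA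
  have hsubset : {ω | ∃ n ≤ N, a ≤ ∑ k ∈ Finset.range n, D k ω} ⊆ A := by
    rintro ω ⟨n, hn, han⟩
    rw [hA, Set.mem_ofPred_eq, Finset.le_sup'_iff]
    refine ⟨n, Finset.mem_range.2 (by omega), ?_⟩
    rw [hexp n hn, Real.coe_toNNReal _ (Real.exp_pos _).le]
    exact Real.exp_le_exp.2 (by gcongr)
  refine (measure_mono hsubset).trans ?_
  have h3 : ENNReal.ofReal (Real.exp (lam * a)) * μ A ≤ ENNReal.ofReal (Real.exp ((1 + η) * lam ^ 2 * Y / 2)) := by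
    refine hmax.trans (ENNReal.ofReal_le_ofReal ?_)
    refine le_trans (setIntegral_le_integral (h.EP_int _ _ _) (ae_of_all _ fun ω => (EP_pos D v l 0 N ω).le)) hitg
  rw [Real.exp_add, ENNReal.ofReal_mul (Real.exp_pos _).le]
  calc μ A = ENNReal.ofReal (Real.exp (-lam * a)) * (ENNReal.ofReal (Real.exp (lam * a)) * μ A) := by
        rw [← mul_assoc, ← ENNReal.ofReal_mul (Real.exp_pos _).le, ← Real.exp_add]; simp
    _ ≤ _ := by gcongr

theorem upper (h : BMD μ ℱ D v B) {c β K κ : ℝ} (hc : 0 ≤ c) (hβ0 : 0 ≤ β) (hβ : β < 1 / 2)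
    (hB : ∀ k : ℕ, B k ≤ c * ((k : ℝ) + 1) ^ β) (hK : 0 < K)
    (hV : ∀ᵐ ω ∂μ, ∀ n : ℕ, ∑ k ∈ Finset.range n, v k ω ≤ K * n) (hκ0 : 0 < κ) (hκ : K < κ ^ 2) :
    ∀ᵐ ω ∂μ, ∀ᶠ n : ℕ in atTop, ∑ k ∈ Finset.range n, D k ω ≤ κ * LL n := by
  -- choose parameters
  set r := κ ^ 2 / K with hr
  have hr1 : 1 < r := by rw [hr, lt_div_iff₀ hK]; linarith
  set η := min 1 ((r - 1) / 4) with hη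
  have hη0 : 0 < η := lt_min one_pos (by linarith)
  have hη1 : η ≤ 1 := min_le_left _ _
  have hη2 : η ≤ (r - 1) / 4 := min_le_right _ _
  set ρ := 1 + η with hρ
  have hρ1 : 1 < ρ := by linarith
  have hρ0 : 0 < ρ := by linarith
  set p := r / ((1 + η) * ρ) with hp
  have hp1 : 1 < p := by
    rw [hp, lt_div_iff₀ (by positivity), hρ]; nlinarith
  have hlogρ : 0 < Real.log ρ := Real.log_pos hρ1
  have hpow : Tendsto (fun j : ℕ => ρ ^ j) atTop atTop := tendsto_pow_atTop_atTop_of_one_lt hρ1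
  have hpow1 : Tendsto (fun j : ℕ => ρ ^ (j + 1)) atTop atTop := hpow.comp (tendsto_add_atTop_nat 1)
  set lam : ℕ → ℝ := fun j => κ * LL (ρ ^ j) / ((1 + η) * K * ρ ^ (j + 1)) with hlam
  -- the multiplier is small
  have hsmall : ∀ᶠ j : ℕ in atTop, κ * c / ((1 + η) * K) * (LL (ρ ^ (j + 1)) * (ρ ^ (j + 1)) ^ (β - 1)) ≤ η := by
    have := ((LL_small hβ).comp hpow1).const_mul (κ * c / ((1 + η) * K))
    rw [mul_zero] at this
    exact (this.eventually (gt_mem_nhds hη0)).mono fun j hj => le_of_lt hj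
  have hbig : ∀ᶠ j : ℕ in atTop, Real.exp 1 < ρ ^ j := hpow.eventually_gt_atTop _
  obtain ⟨J, hJ⟩ := eventually_atTop.1 (hsmall.and hbig)
  set s : ℕ → Set Ω := fun j => {ω | ∃ n ≤ ⌊ρ ^ (j + J + 1)⌋₊, κ * LL (ρ ^ (j + J)) ≤ ∑ k ∈ Finset.range n, D k ω} with hs
  have hbound : ∀ j, μ (s j) ≤ ENNReal.ofReal ((((j + J : ℕ) : ℝ) * Real.log ρ) ^ (-p)) := by
    intro j
    obtain ⟨hj1, hj2⟩ := hJ (j + J) (by omega)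
    set i := j + J with hi
    set x := ρ ^ (i + 1) with hx
    have hx0 : 0 < x := by positivity
    have hxi : ρ ^ i ≤ x := pow_le_pow_right₀ hρ1.le (by omega)
    have hloglog : 0 < Real.log (Real.log (ρ ^ i)) := by
      have := (Real.lt_log_iff_exp_lt (by positivity)).2 hj2
      exact Real.log_pos this
    have hLLpos : 0 < LL (ρ ^ i) := Real.sqrt_pos.2 (by positivity)
    have hlp : 0 < lam i := by rw [hlam]; positivity
    have hNx : (⌊x⌋₊ : ℝ) ≤ x := Nat.floor_le hx0.le
    have hbb : ∀ k < ⌊x⌋₊, lam i * B k ≤ η := by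
      intro k hk
      have hk1 : (k : ℝ) + 1 ≤ x := by
        have : ((k + 1 : ℕ) : ℝ) ≤ ⌊x⌋₊ := by exact_mod_cast hk
        push_cast at this; linarith
      calc lam i * B k ≤ lam i * (c * x ^ β) := by
            gcongr
            refine (hB k).trans ?_
            gcongr
        _ ≤ κ * LL x / ((1 + η) * K * x) * (c * x ^ β) := by
            have hlami : lam i = κ * LL (ρ ^ i) / ((1 + η) * K * x) := rfl
            rw [hlami]
            gcongr
            exact LL_mono hj2.le hxi
        _ = κ * c / ((1 + η) * K) * (LL x * x ^ (β - 1)) := by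
            rw [Real.rpow_sub hx0, Real.rpow_one]; field_simp
        _ ≤ η := hj1
    have hVV : ∀ᵐ ω ∂μ, ∑ k ∈ Finset.range ⌊x⌋₊, v k ω ≤ K * x := by
      filter_upwards [hV] with ω hω
      refine (hω _).trans (by gcongr)
    refine (h.maxBound hlp hη0.le hη1 hbb hVV _).trans (ENNReal.ofReal_le_ofReal ?_)
    have hsq : LL (ρ ^ i) ^ 2 = 2 * ρ ^ i * Real.log (Real.log (ρ ^ i)) := Real.sq_sqrt (by positivity)
    have e1 : -lam i * (κ * LL (ρ ^ i)) + (1 + η) * lam i ^ 2 * (K * x) / 2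
        = - (p * Real.log (Real.log (ρ ^ i))) := by
      have : -lam i * (κ * LL (ρ ^ i)) + (1 + η) * lam i ^ 2 * (K * x) / 2
        = - (κ ^ 2 * LL (ρ ^ i) ^ 2 / (2 * (1 + η) * K * x)) := by
        rw [hlam]; field_simp; ring
      rw [this, hsq, hp, hr, hx, pow_succ]
      field_simp
      ring
    have e2 : Real.log (ρ ^ i) = i * Real.log ρ := by rw [Real.log_pow]
    have e3 : 0 < Real.log (ρ ^ i) := by
      have := (Real.lt_log_iff_exp_lt (by positivity)).2 hj2
      linarith
    rw [e1, ← e2, Real.rpow_def_of_pos e3]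
    apply le_of_eq; congr 1; ring
  have hsum : ∑' j, μ (s j) ≠ ⊤ := by
    have hS : Summable fun j : ℕ => (((j + J : ℕ) : ℝ) * Real.log ρ) ^ (-p) := by
      have h1 : Summable fun j : ℕ => ((j : ℝ)) ^ (-p) * Real.log ρ ^ (-p) :=
        (Real.summable_nat_rpow.2 (by linarith)).mul_right _
      have h2 := (summable_nat_add_iff J).2 h1
      refine h2.congr fun j => ?_
      rw [Real.mul_rpow (by positivity) hlogρ.le]
    refine ne_top_of_le_ne_top hS.tsum_ofReal_ne_top (ENNReal.tsum_le_tsum hbound)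
  filter_upwards [ae_eventually_notMem hsum] with ω hω
  obtain ⟨J', hJ'⟩ := eventually_atTop.1 hω
  have hge : ∀ᶠ n : ℕ in atTop, ρ ^ (J + J' + 1) ≤ (n : ℝ) :=
    tendsto_natCast_atTop_atTop.eventually_ge_atTop _
  filter_upwards [hge] with n hn
  have hn1 : (1 : ℝ) ≤ n := le_trans (one_le_pow₀ hρ1.le) hn
  obtain ⟨i, hi1, hi2⟩ := exists_nat_pow_near hn1 hρ1
  have hiJ : J + J' ≤ i := by
    have := (pow_lt_pow_iff_right₀ hρ1).1 (hn.trans_lt hi2)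
    omega
  obtain ⟨j, rfl⟩ : ∃ j, i = j + J := ⟨i - J, by omega⟩
  have := hJ' j (by omega)
  simp only [hs, Set.mem_ofPred_eq, not_exists, not_and, not_le] at this
  have h3 := this n (Nat.le_floor hi2.le)
  refine h3.le.trans ?_
  gcongr
  exact LL_mono (hJ (j + J) (by omega)).2.le hi1

end BMD

/-- the test function used for the lower half of the LIL -/
def HF (ε x s : ℝ) : ℝ := Real.exp (x - (1 - ε ^ 2) * s)
  - 1 / 4 * Real.exp ((1 - ε) * x - (1 + ε ^ 2) * ((1 - ε) ^ 2 * s))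
  - 1 / 4 * Real.exp ((1 + ε) * x - (1 + ε ^ 2) * ((1 + ε) ^ 2 * s))

lemma HF_lower {ε x s : ℝ} (hε : 0 < ε) (hε1 : ε ≤ 1 / 2) (hs : 0 ≤ s) (hH : 0 < HF ε x s) :
    (2 - 3 * ε) * s - Real.log 4 / ε ≤ x := by
  have h1 : 1 / 4 * Real.exp ((1 - ε) * x - (1 + ε ^ 2) * ((1 - ε) ^ 2 * s)) <
      Real.exp (x - (1 - ε ^ 2) * s) := by
    unfold HF at hH
    have := Real.exp_pos ((1 + ε) * x - (1 + ε ^ 2) * ((1 + ε) ^ 2 * s))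
    linarith
  have e : (1 / 4 : ℝ) = Real.exp (- Real.log 4) := by
    rw [Real.exp_neg, Real.exp_log (by norm_num)]; norm_num
  rw [e, ← Real.exp_add, Real.exp_lt_exp] at h1
  have h2 : (ε * (2 - 3 * ε)) * s - Real.log 4 ≤ ε * x := by
    have : ε * (2 - 3 * ε) * s ≤ ((1 - ε ^ 2) - (1 + ε ^ 2) * (1 - ε) ^ 2) * s := by
      gcongr
      nlinarith [mul_pos hε hε, mul_pos (mul_pos hε hε) hε]
    nlinarith
  have h3 : (2 - 3 * ε) * s - Real.log 4 / ε = ((ε * (2 - 3 * ε)) * s - Real.log 4) / ε := by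
    field_simp
  rw [h3, div_le_iff₀ hε]; linarith

lemma HF_upper {ε x s t : ℝ} (hε : 0 < ε) (hε1 : ε ≤ 1 / 2) (hs : 0 ≤ s) (hst : s ≤ t) :
    max (HF ε x s) 0 ≤ Real.exp (Real.log 4 / ε + (1 + 6 * ε) * t) := by
  refine max_le ?_ (Real.exp_pos _).le
  by_cases hH : 0 < HF ε x s
  swap
  · exact (not_lt.1 hH).trans (Real.exp_pos _).le
  have h1 : 1 / 4 * Real.exp ((1 + ε) * x - (1 + ε ^ 2) * ((1 + ε) ^ 2 * s)) <
      Real.exp (x - (1 - ε ^ 2) * s) := by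
    unfold HF at hH
    have := Real.exp_pos ((1 - ε) * x - (1 + ε ^ 2) * ((1 - ε) ^ 2 * s))
    linarith
  have e : (1 / 4 : ℝ) = Real.exp (- Real.log 4) := by
    rw [Real.exp_neg, Real.exp_log (by norm_num)]; norm_num
  rw [e, ← Real.exp_add, Real.exp_lt_exp] at h1
  have h2 : ε * x ≤ (ε * (2 + 5 * ε)) * s + Real.log 4 := by
    have : ((1 + ε ^ 2) * (1 + ε) ^ 2 - (1 - ε ^ 2)) * s ≤ ε * (2 + 5 * ε) * s := by
      gcongr
      have a3 : ε ^ 3 ≤ 1 / 2 * ε ^ 2 := by nlinarith [mul_pos hε hε]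
      have a4 : ε ^ 4 ≤ 1 / 4 * ε ^ 2 := by nlinarith [mul_pos hε hε]
      nlinarith
    nlinarith
  have h3 : x ≤ (2 + 5 * ε) * s + Real.log 4 / ε := by
    have h3 : (2 + 5 * ε) * s + Real.log 4 / ε = ((ε * (2 + 5 * ε)) * s + Real.log 4) / ε := by
      field_simp
    rw [h3, le_div_iff₀ hε]; linarith
  have h4 : HF ε x s ≤ Real.exp (x - (1 - ε ^ 2) * s) := by
    unfold HF
    have := Real.exp_pos ((1 - ε) * x - (1 + ε ^ 2) * ((1 - ε) ^ 2 * s))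
    have := Real.exp_pos ((1 + ε) * x - (1 + ε ^ 2) * ((1 + ε) ^ 2 * s))
    linarith
  refine h4.trans (Real.exp_le_exp.2 ?_)
  have h5 : (1 + 5 * ε + ε ^ 2) * s ≤ (1 + 6 * ε) * t := by
    have : (1 + 5 * ε + ε ^ 2) ≤ (1 + 6 * ε) := by nlinarith
    gcongr
  nlinarith

namespace BMD

variable {Ω : Type*} {m0 : MeasurableSpace Ω} {μ : Measure Ω} [IsProbabilityMeasure μ]
  {ℱ : Filtration ℕ m0} {D v : ℕ → Ω → ℝ} {B : ℕ → ℝ}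

lemma EP_block (D v : ℕ → Ω → ℝ) {m N : ℕ} (lam s : ℝ) (ω : Ω) :
    EP D v (fun k => if m ≤ k ∧ k < N then lam else 0) s N ω =
      Real.exp (lam * (∑ k ∈ Finset.Ico m N, D k ω) - s * (lam ^ 2 / 2 * ∑ k ∈ Finset.Ico m N, v k ω)) := by
  unfold EP
  congr 1
  rw [Finset.mul_sum, Finset.mul_sum, Finset.mul_sum, ← Finset.sum_sub_distrib]
  symm
  have : Finset.Ico m N ⊆ Finset.range N := by
    intro k hk; simp at hk ⊢; omega
  refine (Finset.sum_congr rfl fun k hk => ?_).trans (Finset.sum_subset this fun k hk hk' => ?_)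
  · have := Finset.mem_Ico.1 hk
    simp only [this, and_self, if_true]; ring
  · have hk1 : ¬ (m ≤ k ∧ k < N) := by simpa using hk'
    simp [hk1]

lemma EP_block_one (D v : ℕ → Ω → ℝ) {m N : ℕ} (lam s : ℝ) :
    EP D v (fun k => if m ≤ k ∧ k < N then lam else 0) s m = 1 := by
  ext ω
  unfold EP
  rw [Finset.sum_eq_zero]
  · simp
  · intro k hk
    have : ¬ (m ≤ k ∧ k < N) := by have := Finset.mem_range.1 hk; omega
    simp [this]

lemma block (h : BMD μ ℱ D v B) {m N : ℕ} (hmN : m ≤ N) {lam ε : ℝ} (hlam : 0 < lam) (hε : 0 < ε)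
    (hε1 : ε ≤ 1 / 2) (hB : ∀ k < N, lam * B k ≤ ε ^ 2 / 2) :
    StronglyMeasurable[ℱ N] (fun ω => HF ε (lam * ∑ k ∈ Finset.Ico m N, D k ω)
      (lam ^ 2 / 2 * ∑ k ∈ Finset.Ico m N, v k ω)) ∧
    Integrable (fun ω => HF ε (lam * ∑ k ∈ Finset.Ico m N, D k ω)
      (lam ^ 2 / 2 * ∑ k ∈ Finset.Ico m N, v k ω)) μ ∧
    ∀ᵐ ω ∂μ, 1 / 2 ≤ (μ[fun ω => HF ε (lam * ∑ k ∈ Finset.Ico m N, D k ω)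
      (lam ^ 2 / 2 * ∑ k ∈ Finset.Ico m N, v k ω) | ℱ m]) ω := by
  set l : ℝ → ℕ → ℝ := fun a k => if m ≤ k ∧ k < N then a else 0 with hl
  have hη1 : ε ^ 2 ≤ 1 := by nlinarith
  have hlB : ∀ a, |a| ≤ 2 → ∀ k, |l (a * lam) k| * B k ≤ ε ^ 2 := by
    intro a ha k
    by_cases hk : m ≤ k ∧ k < N
    · simp only [hl, hk, and_self, if_true, abs_mul, abs_of_pos hlam]
      have := hB k hk.2
      have h2 : |a| * lam * B k ≤ |a| * (ε ^ 2 / 2) := by rw [mul_assoc]; gcongr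
      nlinarith [sq_nonneg ε]
    · simp only [hl, hk, if_false]; simp; positivity
  have e : (fun ω => HF ε (lam * ∑ k ∈ Finset.Ico m N, D k ω)
      (lam ^ 2 / 2 * ∑ k ∈ Finset.Ico m N, v k ω)) =
      EP D v (l (1 * lam)) (1 - ε ^ 2) N - (1 / 4 : ℝ) • EP D v (l ((1 - ε) * lam)) (1 + ε ^ 2) N
        - (1 / 4 : ℝ) • EP D v (l ((1 + ε) * lam)) (1 + ε ^ 2) N := by
    ext ω
    simp only [Pi.sub_apply, Pi.smul_apply, hl, EP_block, HF, smul_eq_mul]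
    congr 1
    · congr 1
      · congr 1; ring
      · congr 2; ring
    · congr 2; ring
  have b1 : |(1 : ℝ)| ≤ 2 := by norm_num
  have b2 : |1 - ε| ≤ 2 := by rw [abs_le]; constructor <;> linarith
  have b3 : |1 + ε| ≤ 2 := by rw [abs_le]; constructor <;> linarith
  rw [e]
  have i1 := h.EP_int (l (1 * lam)) (1 - ε ^ 2) N
  have i2 := (h.EP_int (l ((1 - ε) * lam)) (1 + ε ^ 2) N).smul (1 / 4 : ℝ)
  have i3 := (h.EP_int (l ((1 + ε) * lam)) (1 + ε ^ 2) N).smul (1 / 4 : ℝ)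
  refine ⟨?_, (i1.sub i2).sub i3, ?_⟩
  · exact ((h.EP_meas _ _ N).sub ((h.EP_meas _ _ N).const_smul _)).sub
      ((h.EP_meas _ _ N).const_smul _)
  have c1 := (h.EP_sub (l (1 * lam)) hη1 (hlB _ b1) le_rfl).2.1 m N hmN
  have c2 := (h.EP_super (l ((1 - ε) * lam)) hη1 (hlB _ b2)).2.1 m N hmN
  have c3 := (h.EP_super (l ((1 + ε) * lam)) hη1 (hlB _ b3)).2.1 m N hmN
  simp only [hl, EP_block_one] at c1 c2 c3
  filter_upwards [c1, c2, c3, condExp_sub (m := ℱ m) (i1.sub i2) i3, condExp_sub (m := ℱ m) i1 i2,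
    condExp_smul (μ := μ) (1 / 4 : ℝ) (EP D v (l ((1 - ε) * lam)) (1 + ε ^ 2) N) (ℱ m),
    condExp_smul (μ := μ) (1 / 4 : ℝ) (EP D v (l ((1 + ε) * lam)) (1 + ε ^ 2) N) (ℱ m)]
    with ω c1 c2 c3 d1 d2 d3 d4
  rw [d1, Pi.sub_apply, d2, Pi.sub_apply, d3, d4, Pi.smul_apply, Pi.smul_apply]
  simp only [Pi.one_apply, hl] at c1 c2 c3
  simp only [hl, smul_eq_mul]
  linarith

lemma condBC {G : Filtration ℕ m0} {U : ℕ → Ω → ℝ} (hU : ∀ j, StronglyMeasurable[G (j + 1)] (U j))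
    (h0 : ∀ j ω, 0 ≤ U j ω) (h1 : ∀ j, ∀ᵐ ω ∂μ, U j ω ≤ 1) (a : ℕ → ℝ)
    (ha : ∀ j, ∀ᵐ ω ∂μ, a j ≤ (μ[U j | G j]) ω)
    (hsum : Tendsto (fun n => ∑ j ∈ Finset.range n, a j) atTop atTop) :
    ∀ᵐ ω ∂μ, ∃ᶠ j in atTop, 0 < U j ω := by
  set f : ℕ → Ω → ℝ := fun n => ∑ j ∈ Finset.range n, U j with hf
  have hitg : ∀ j, Integrable (U j) μ := fun j =>
    Integrable.of_bound ((hU j).mono (G.le _)).aestronglyMeasurable 1 (by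
      filter_upwards [h1 j] with ω hω
      rw [Real.norm_eq_abs, abs_of_nonneg (h0 j ω)]; exact hω)
  have hdiff : ∀ n, f (n + 1) - f n = U n := by
    intro n; simp [hf, Finset.sum_range_succ]
  have key := tendsto_sum_indicator_atTop_iff (μ := μ) (ℱ := G) (f := f) (R := 1)
    (ae_of_all _ fun ω n => by
      have := congrFun (hdiff n) ω
      simp only [Pi.sub_apply] at this
      linarith [h0 n ω])
    (fun n => Finset.stronglyMeasurable_sum _ fun k hk =>
      (hU k).mono (G.mono (Finset.mem_range.1 hk)))
    (fun n => integrable_finsetSum' _ fun k _ => hitg k)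
    (by
      filter_upwards [ae_all_iff.2 h1] with ω hω n
      have := congrFun (hdiff n) ω
      simp only [Pi.sub_apply] at this
      rw [this, abs_of_nonneg (h0 n ω)]; exact_mod_cast hω n)
  filter_upwards [key, ae_all_iff.2 ha] with ω hk hω
  have hp : Tendsto (fun n => predictablePart f G μ n ω) atTop atTop := by
    refine tendsto_atTop_mono (fun n => ?_) hsum
    simp only [predictablePart, hdiff, Finset.sum_apply]
    exact Finset.sum_le_sum fun j _ => hω j
  have hT := hk.2 hp
  by_contra hcon
  rw [not_frequently] at hcon
  obtain ⟨J, hJ⟩ := eventually_atTop.1 hcon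
  have hz : ∀ n, J ≤ n → f n ω = f J ω := by
    intro n hn
    induction n, hn using Nat.le_induction with
    | base => rfl
    | succ n hn ih =>
      have := congrFun (hdiff n) ω
      simp only [Pi.sub_apply] at this
      have h2 : U n ω = 0 := le_antisymm (not_lt.1 (hJ n hn)) (h0 n ω)
      linarith
  obtain ⟨n, hn1, hn2⟩ := ((hT.eventually_gt_atTop (f J ω)).and (eventually_ge_atTop J)).exists
  rw [hz n hn2] at hn1
  exact lt_irrefl _ hn1

end BMD

namespace BMD

variable {Ω : Type*} {m0 : MeasurableSpace Ω} {μ : Measure Ω} [IsProbabilityMeasure μ]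
  {ℱ : Filtration ℕ m0} {D v : ℕ → Ω → ℝ} {B : ℕ → ℝ}

set_option maxHeartbeats 3000000 in
theorem lower (h : BMD μ ℱ D v B) {c β ε : ℝ} (hc : 0 ≤ c) (hβ0 : 0 ≤ β) (hβ : β < 1 / 2)
    (hB : ∀ k : ℕ, B k ≤ c * ((k : ℝ) + 1) ^ β) (hε : 0 < ε) (hε1 : ε ≤ 1 / 2)
    (hV : ∀ᵐ ω ∂μ, ∀ n : ℕ, ∑ k ∈ Finset.range n, v k ω ≤ (1 + ε) * n)
    (hVl : ∀ᵐ ω ∂μ, Tendsto (fun n : ℕ => (∑ k ∈ Finset.range n, v k ω) / (n : ℝ)) atTop (𝓝 1)) :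
    ∀ᵐ ω ∂μ, ∃ᶠ n : ℕ in atTop, (1 - 13 * ε) * LL n ≤ ∑ k ∈ Finset.range n, D k ω := by
  obtain ⟨ρ, hρ⟩ := exists_nat_ge (4 / ε ^ 2)
  have hρe : 4 ≤ ε ^ 2 * ρ := by rw [div_le_iff₀ (by positivity)] at hρ; linarith
  have hρ2 : (1 : ℝ) < ρ := by nlinarith
  have hρn : 1 < ρ := by exact_mod_cast hρ2
  have hρ0 : (0 : ℝ) < ρ := by linarith
  have hlogρ : 0 < Real.log ρ := Real.log_pos hρ2
  set q := 1 / ((1 + 6 * ε) * (1 + ε)) with hq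
  have hq0 : 0 < q := by positivity
  have hq1 : q ≤ 1 := by
    rw [hq, div_le_one (by positivity)]; nlinarith
  have hq8 : 1 - 8 * ε ≤ q := by
    rw [hq, le_div_iff₀ (by positivity)]; nlinarith [mul_pos hε hε, mul_pos (mul_pos hε hε) hε]
  set θ := Real.sqrt q with hθ
  have hθ0 : 0 < θ := Real.sqrt_pos.2 hq0
  have hθ2 : θ ^ 2 = q := Real.sq_sqrt hq0.le
  have hθq : q ≤ θ := by
    have : θ ≤ 1 := by rw [hθ]; exact Real.sqrt_le_one.2 hq1
    nlinarith
  have hpow : Tendsto (fun j : ℕ => (ρ : ℝ) ^ j) atTop atTop := tendsto_pow_atTop_atTop_of_one_lt hρ2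
  have hpow1 : Tendsto (fun j : ℕ => (ρ : ℝ) ^ (j + 1)) atTop atTop := hpow.comp (tendsto_add_atTop_nat 1)
  have hsmall : ∀ᶠ j : ℕ in atTop, θ * c * (LL ((ρ : ℝ) ^ (j + 1)) * ((ρ : ℝ) ^ (j + 1)) ^ (β - 1)) ≤ ε ^ 2 / 2 := by
    have := ((LL_small hβ).comp hpow1).const_mul (θ * c)
    rw [mul_zero] at this
    exact (this.eventually (gt_mem_nhds (by positivity : (0 : ℝ) < ε ^ 2 / 2))).mono fun j hj => le_of_lt hj
  have hbig : ∀ᶠ j : ℕ in atTop, Real.exp 1 < (ρ : ℝ) ^ j := hpow.eventually_gt_atTop _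
  have hll : ∀ᶠ j : ℕ in atTop, Real.log 4 / (2 * ε ^ 2 * θ) ≤ Real.log (Real.log ((ρ : ℝ) ^ (j + 1))) :=
    (Real.tendsto_log_atTop.comp (Real.tendsto_log_atTop.comp hpow1)).eventually_ge_atTop _
  obtain ⟨J, hJ⟩ := eventually_atTop.1 (hsmall.and (hbig.and hll))
  -- abbreviations for the block quantities
  set x : ℕ → ℝ := fun j => (ρ : ℝ) ^ (j + J + 1) with hx
  set lam : ℕ → ℝ := fun j => θ * LL (x j) / x j with hlam
  set Λ : ℕ → ℝ := fun j => Real.log (Real.log (x j)) with hΛ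
  have hx0 : ∀ j, 0 < x j := fun j => by simp only [hx]; positivity
  have hxe : ∀ j, Real.exp 1 < x j := fun j => by
    have := (hJ (j + J + 1) (by omega)).2.1
    exact this
  have hlogx : ∀ j, 1 < Real.log (x j) := fun j => (Real.lt_log_iff_exp_lt (hx0 j)).2 (hxe j)
  have hΛ0 : ∀ j, 0 < Λ j := fun j => Real.log_pos (hlogx j)
  have hLsq : ∀ j, LL (x j) ^ 2 = 2 * x j * Λ j := fun j =>
    Real.sq_sqrt (by have := hx0 j; have := hΛ0 j; positivity)
  have hL0 : ∀ j, 0 < LL (x j) := fun j =>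
    Real.sqrt_pos.2 (by have := hx0 j; have := hΛ0 j; simp only [hΛ] at this; positivity)
  have hlam0 : ∀ j, 0 < lam j := fun j => by
    have := hx0 j; have := hL0 j
    simp only [hlam]; positivity
  have hlamsq : ∀ j, lam j ^ 2 / 2 * x j = q * Λ j := fun j => by
    have := (hx0 j).ne'
    simp only [hlam]
    rw [div_pow, mul_pow, hLsq, hθ2]; field_simp
  have hlamL : ∀ j, lam j * LL (x j) = 2 * θ * Λ j := fun j => by
    have := (hx0 j).ne'
    have e : lam j * LL (x j) = θ * LL (x j) ^ 2 / x j := by simp only [hlam]; ring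
    rw [e, hLsq]; field_simp
  have hNx : ∀ j, ((ρ ^ (j + J + 1) : ℕ) : ℝ) = x j := fun j => by simp only [hx]; push_cast; rfl
  have hlB : ∀ j, ∀ k < ρ ^ (j + J + 1), lam j * B k ≤ ε ^ 2 / 2 := by
    intro j k hk
    have hk1 : (k : ℝ) + 1 ≤ x j := by
      rw [← hNx]; exact_mod_cast hk
    have := hx0 j
    calc lam j * B k ≤ lam j * (c * x j ^ β) := by
          have := (hlam0 j).le
          gcongr
          refine (hB k).trans ?_
          gcongr
      _ = θ * c * (LL (x j) * x j ^ (β - 1)) := by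
          simp only [hlam]
          rw [Real.rpow_sub (hx0 j), Real.rpow_one]; field_simp
      _ ≤ _ := (hJ (j + J) (by omega)).1
  have hmN : ∀ j, ρ ^ (j + J) ≤ ρ ^ (j + J + 1) := fun j => Nat.pow_le_pow_right (by omega) (by omega)
  set H : ℕ → Ω → ℝ := fun j ω => HF ε (lam j * ∑ k ∈ Finset.Ico (ρ ^ (j + J)) (ρ ^ (j + J + 1)), D k ω)
      (lam j ^ 2 / 2 * ∑ k ∈ Finset.Ico (ρ ^ (j + J)) (ρ ^ (j + J + 1)), v k ω) with hH
  have hblock := fun j => h.block (hmN j) (hlam0 j) hε hε1 (hlB j)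
  set C := Real.exp (Real.log 4 / ε) with hC
  have hC0 : 0 < C := Real.exp_pos _
  set M : ℕ → ℝ := fun j => C * Real.log (x j) with hM
  have hM0 : ∀ j, 0 < M j := fun j => by
    have := hlogx j
    simp only [hM]; positivity
  have hvnn : ∀ᵐ ω ∂μ, ∀ k, 0 ≤ v k ω := ae_all_iff.2 h.vnn
  have hble : ∀ j, ∀ᵐ ω ∂μ, max (H j ω) 0 ≤ M j := by
    intro j
    filter_upwards [hV, hvnn] with ω h1 h2
    have hs0 : 0 ≤ ∑ k ∈ Finset.Ico (ρ ^ (j + J)) (ρ ^ (j + J + 1)), v k ω :=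
      Finset.sum_nonneg fun k _ => h2 k
    have hs1 : ∑ k ∈ Finset.Ico (ρ ^ (j + J)) (ρ ^ (j + J + 1)), v k ω ≤ (1 + ε) * x j := by
      rw [← hNx]
      refine le_trans ?_ (h1 _)
      refine Finset.sum_le_sum_of_subset_of_nonneg ?_ fun k _ _ => h2 k
      intro k hk; simp at hk ⊢; omega
    refine (HF_upper (t := lam j ^ 2 / 2 * ((1 + ε) * x j)) hε hε1 (by positivity) (by gcongr)).trans ?_
    have e1 : lam j ^ 2 / 2 * ((1 + ε) * x j) = (1 + ε) * (q * Λ j) := by rw [← hlamsq]; ring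
    have e2 : (1 + 6 * ε) * ((1 + ε) * (q * Λ j)) = Λ j := by
      rw [hq]; field_simp
    rw [e1, e2, Real.exp_add]
    have e3 : Real.exp (Λ j) = Real.log (x j) := Real.exp_log (by linarith [hlogx j])
    rw [e3]
  set G : Filtration ℕ m0 :=
    { seq := fun j => ℱ (ρ ^ (j + J))
      mono' := fun i j hij => ℱ.mono (Nat.pow_le_pow_right (by omega) (by omega))
      le' := fun j => ℱ.le _ } with hG
  have hGe : ∀ j, G j = ℱ (ρ ^ (j + J)) := fun j => rfl
  set U : ℕ → Ω → ℝ := fun j ω => max (H j ω) 0 / M j with hU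
  have hfreq : ∀ᵐ ω ∂μ, ∃ᶠ j in atTop, 0 < U j ω := by
    refine condBC (G := G) (U := U) ?_ ?_ ?_ (fun j => 1 / (2 * C * Real.log ρ) * (((j + (J + 1) : ℕ) : ℝ))⁻¹) ?_ ?_
    · intro j
      have e : j + 1 + J = j + J + 1 := by omega
      rw [hGe, e]
      have hcont : Continuous (fun y : ℝ => max y 0 / M j) :=
        (continuous_id.max continuous_const).div_const _
      exact hcont.comp_stronglyMeasurable (hblock j).1
    · intro j ω
      exact div_nonneg (le_max_right _ _) (hM0 j).le
    · intro j
      filter_upwards [hble j] with ω hω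
      simp only [hU]
      rw [div_le_one (hM0 j)]; exact hω
    · intro j
      have hHi : Integrable (H j) μ := (hblock j).2.1
      have hmono : μ[(1 / M j) • H j | G j] ≤ᵐ[μ] μ[U j | G j] := by
        refine condExp_mono (hHi.smul _) ?_ (ae_of_all _ fun ω => ?_)
        · exact (hHi.sup (integrable_zero _ _ _)).div_const _
        · have := (hM0 j).le
          simp only [hU, Pi.smul_apply, smul_eq_mul]
          rw [one_div, inv_mul_eq_div]
          gcongr
          exact le_max_left _ _
      filter_upwards [hmono, (hblock j).2.2, condExp_smul (μ := μ) (1 / M j) (H j) (G j)] with ω h1 h2 h3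
      refine le_trans ?_ h1
      rw [h3, Pi.smul_apply, smul_eq_mul, hGe]
      have h4 : 1 / M j * (1 / 2) ≤ 1 / M j * (μ[H j|ℱ (ρ ^ (j + J))]) ω := by
        have := (hM0 j).le
        exact mul_le_mul_of_nonneg_left h2 (by positivity)
      refine le_trans (le_of_eq ?_) h4
      have e : Real.log (x j) = ((j + (J + 1) : ℕ) : ℝ) * Real.log ρ := by
        simp only [hx]; rw [Real.log_pow, add_assoc]
      simp only [hM]
      rw [e]
      have : (((j + (J + 1) : ℕ) : ℝ)) ≠ 0 := by positivity
      field_simp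
    · have hns : ¬ Summable (fun j : ℕ => 1 / (2 * C * Real.log ρ) * (((j + (J + 1) : ℕ) : ℝ))⁻¹) := by
        rw [summable_mul_left_iff (by positivity)]
        rw [summable_nat_add_iff (f := fun n : ℕ => ((n : ℝ))⁻¹) (J + 1)]
        exact Real.not_summable_natCast_inv
      exact (not_summable_iff_tendsto_nat_atTop_of_nonneg (fun j => by positivity)).1 hns
  have hup := h.neg.upper (κ := 2) hc hβ0 hβ hB (by positivity : 0 < 1 + ε) hV (by norm_num) (by linarith)
  have htN : Tendsto (fun j : ℕ => ρ ^ (j + J + 1)) atTop atTop :=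
    (tendsto_pow_atTop_atTop_of_one_lt hρn).comp (tendsto_add_atTop_nat (J + 1))
  have htm : Tendsto (fun j : ℕ => ρ ^ (j + J)) atTop atTop :=
    (tendsto_pow_atTop_atTop_of_one_lt hρn).comp (tendsto_add_atTop_nat J)
  filter_upwards [hfreq, hup, hV, hVl, hvnn] with ω w1 w2 w3 w4 w5
  have g1 := htm.eventually w2
  have g2 := htN.eventually (w4.eventually (lt_mem_nhds (by linarith : 1 - ε / 2 < 1)))
  refine htN.frequently ((w1.and_eventually (g1.and g2)).mono ?_)
  rintro j ⟨hUj, hj1, hj2⟩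
  have hHj : 0 < H j ω := by
    by_contra hneg
    simp only [hU, max_eq_right (not_lt.1 hneg), zero_div, lt_irrefl] at hUj
  set b := ∑ k ∈ Finset.Ico (ρ ^ (j + J)) (ρ ^ (j + J + 1)), v k ω with hb
  set Y := ∑ k ∈ Finset.Ico (ρ ^ (j + J)) (ρ ^ (j + J + 1)), D k ω with hY
  have hb0 : 0 ≤ b := Finset.sum_nonneg fun k _ => w5 k
  have hlow := HF_lower hε hε1 (by have := hlam0 j; positivity) hHj
  have hmx : ((ρ ^ (j + J) : ℕ) : ℝ) * ρ = x j := by simp only [hx]; push_cast; rw [pow_succ]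
  set m : ℝ := ((ρ ^ (j + J) : ℕ) : ℝ) with hm
  have hm0 : 0 < m := by rw [hm]; push_cast; positivity
  have hm4 : 4 * m ≤ ε ^ 2 * x j := by rw [← hmx]; nlinarith
  have hbge : (1 - ε) * x j ≤ b := by
    have e : b = ∑ k ∈ Finset.range (ρ ^ (j + J + 1)), v k ω - ∑ k ∈ Finset.range (ρ ^ (j + J)), v k ω :=
      Finset.sum_Ico_eq_sub _ (hmN j)
    have f1 := w3 (ρ ^ (j + J))
    rw [← hm] at f1
    rw [hNx, lt_div_iff₀ (hx0 j)] at hj2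
    have f2 : 4 * m ≤ ε * x j := by
      refine hm4.trans ?_
      have := hx0 j
      gcongr; nlinarith
    have f3 : (1 + ε) * m ≤ (3 / 2) * m := mul_le_mul_of_nonneg_right (by linarith) hm0.le
    have f4 : (1 - ε / 2) * x j = x j - ε * x j / 2 := by ring
    have f5 : (1 - ε) * x j = x j - ε * x j := by ring
    rw [e]; linarith
  have hYS : Y = ∑ k ∈ Finset.range (ρ ^ (j + J + 1)), D k ω - ∑ k ∈ Finset.range (ρ ^ (j + J)), D k ω :=
      Finset.sum_Ico_eq_sub _ (hmN j)
  have hme : Real.exp 1 < m := by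
    have := (hJ (j + J) (by omega)).2.1
    rw [hm]; push_cast; exact this
  have hLm : 2 * LL m ≤ ε * LL (x j) := by
    have hmle : m ≤ x j := by rw [← hmx]; nlinarith
    have l1 : 1 < Real.log m := (Real.lt_log_iff_exp_lt hm0).2 hme
    have l2 : Real.log m ≤ Real.log (x j) := Real.log_le_log hm0 hmle
    have l3 : Real.log (Real.log m) ≤ Λ j := Real.log_le_log (by linarith) l2
    have l4 : 0 < Real.log (Real.log m) := Real.log_pos l1
    have l5 : LL m ^ 2 = 2 * m * Real.log (Real.log m) := Real.sq_sqrt (by positivity)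
    have l6 : (2 * LL m) ^ 2 ≤ (ε * LL (x j)) ^ 2 := by
      rw [mul_pow, mul_pow, l5, hLsq]
      calc 2 ^ 2 * (2 * m * Real.log (Real.log m)) = 2 * (4 * m) * Real.log (Real.log m) := by ring
        _ ≤ 2 * (ε ^ 2 * x j) * Λ j := by
          have := hx0 j
          gcongr
        _ = _ := by ring
    have := LL_nonneg (x j)
    exact (pow_le_pow_iff_left₀ (by have := LL_nonneg m; positivity) (by positivity) two_ne_zero).1 l6
  have hYge : (1 - 12 * ε) * LL (x j) ≤ Y := by
    have k1 : (2 - 3 * ε) * ((1 - ε) * (q * Λ j)) ≤ (2 - 3 * ε) * (lam j ^ 2 / 2 * b) := by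
      have : (1 - ε) * (q * Λ j) ≤ lam j ^ 2 / 2 * b := by
        rw [← hlamsq]
        calc (1 - ε) * (lam j ^ 2 / 2 * x j) = lam j ^ 2 / 2 * ((1 - ε) * x j) := by ring
          _ ≤ _ := by gcongr
      have : 0 ≤ 2 - 3 * ε := by linarith
      gcongr
    have k2 : Real.log 4 / ε ≤ 2 * ε * θ * Λ j := by
      have := (hJ (j + J) (by omega)).2.2
      have k3 : Real.log 4 / (2 * ε ^ 2 * θ) ≤ Λ j := this
      rw [div_le_iff₀ (by positivity)] at k3
      rw [div_le_iff₀ hε]; linarith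
    have k4 : (1 - 12 * ε) * (2 * θ) * Λ j ≤ (2 - 3 * ε) * (1 - ε) * q * Λ j - 2 * ε * θ * Λ j := by
      rw [← sub_mul]
      have := (hΛ0 j).le
      gcongr
      have k5 : (1 - 12 * ε) * 2 ≤ (2 - 3 * ε) * (1 - ε) * θ - 2 * ε := by
        have : (2 - 3 * ε) * (1 - ε) * (1 - 8 * ε) ≤ (2 - 3 * ε) * (1 - ε) * θ := by
          have : 0 ≤ (2 - 3 * ε) * (1 - ε) := mul_nonneg (by linarith) (by linarith)
          gcongr; linarith
        nlinarith [mul_pos hε hε]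
      rw [← hθ2]
      nlinarith
    have k6 : lam j * ((1 - 12 * ε) * LL (x j)) ≤ lam j * Y := by
      calc lam j * ((1 - 12 * ε) * LL (x j)) = (1 - 12 * ε) * (lam j * LL (x j)) := by ring
        _ = (1 - 12 * ε) * (2 * θ) * Λ j := by rw [hlamL]; ring
        _ ≤ lam j * Y := by nlinarith
    exact le_of_mul_le_mul_left k6 (hlam0 j)
  rw [Finset.sum_neg_distrib] at hj1
  rw [hNx]
  linarith

end BMD

namespace BMD

variable {Ω : Type*} {m0 : MeasurableSpace Ω} {μ : Measure Ω} [IsProbabilityMeasure μ]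
  {ℱ : Filtration ℕ m0} {D v : ℕ → Ω → ℝ} {B : ℕ → ℝ}

lemma cpoint {l d w η : ℝ} (h1 : η ≤ 1) (hd : |l * d| ≤ η) (hw : 0 ≤ w) (hlw : l ^ 2 * w ≤ η ^ 2) :
    ‖Complex.exp ((l * d : ℝ) * Complex.I) - Complex.exp ((-(l ^ 2 * w / 2) : ℝ))
      - ((l * d : ℝ) * Complex.I - ((l ^ 2 / 2 * (d ^ 2 - w) : ℝ) : ℂ))‖ ≤ η * l ^ 2 * (d ^ 2 + w) := by
  have hη : 0 ≤ η := (abs_nonneg _).trans hd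
  have hn : ‖((l * d : ℝ) : ℂ) * Complex.I‖ = |l * d| := by
    rw [norm_mul, Complex.norm_I, mul_one, Complex.norm_real, Real.norm_eq_abs]
  have a1 : ‖Complex.exp ((l * d : ℝ) * Complex.I) - (1 + (l * d : ℝ) * Complex.I
      - (((l * d) ^ 2 / 2 : ℝ) : ℂ))‖ ≤ η * (l * d) ^ 2 := by
    have := Complex.exp_bound (x := ((l * d : ℝ) : ℂ) * Complex.I) (by rw [hn]; linarith) (n := 3) (by norm_num)
    rw [hn] at this
    have e : ∑ m ∈ Finset.range 3, (((l * d : ℝ) : ℂ) * Complex.I) ^ m / (m.factorial : ℂ)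
        = 1 + (l * d : ℝ) * Complex.I - (((l * d) ^ 2 / 2 : ℝ) : ℂ) := by
      simp only [Finset.sum_range_succ, Finset.sum_range_zero, mul_pow, Complex.I_sq]
      norm_num [Nat.factorial]
      ring
    rw [e] at this
    refine this.trans ?_
    norm_num [Nat.factorial]
    have e : |l * d| ^ 3 = |l * d| * (l * d) ^ 2 := by rw [← sq_abs (l * d)]; ring
    rw [← abs_mul, e]
    nlinarith [sq_nonneg (l * d), mul_le_mul_of_nonneg_right hd (sq_nonneg (l * d)), mul_nonneg hη (sq_nonneg (l * d))]
  have a2 : ‖Complex.exp ((-(l ^ 2 * w / 2) : ℝ)) - (1 - ((l ^ 2 * w / 2 : ℝ) : ℂ))‖ ≤ η * (l ^ 2 * w) := by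
    have hz0 : 0 ≤ l ^ 2 * w := by positivity
    have hz : ‖-(l ^ 2 * w / 2)‖ ≤ 1 := by
      rw [norm_neg, Real.norm_eq_abs, abs_of_nonneg (by positivity)]; nlinarith
    have := Real.norm_exp_sub_one_sub_id_le hz
    rw [norm_neg, Real.norm_eq_abs, Real.norm_eq_abs, abs_of_nonneg (by positivity : 0 ≤ l ^ 2 * w / 2)] at this
    have e : Complex.exp ((-(l ^ 2 * w / 2) : ℝ)) - (1 - ((l ^ 2 * w / 2 : ℝ) : ℂ))
        = ((Real.exp (-(l ^ 2 * w / 2)) - 1 - -(l ^ 2 * w / 2) : ℝ) : ℂ) := by push_cast; ring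
    rw [e, Complex.norm_real, Real.norm_eq_abs]
    refine this.trans ?_
    nlinarith [mul_le_mul_of_nonneg_left hlw hz0, mul_nonneg hη hz0]
  calc _ = ‖(Complex.exp ((l * d : ℝ) * Complex.I) - (1 + (l * d : ℝ) * Complex.I
      - (((l * d) ^ 2 / 2 : ℝ) : ℂ))) - (Complex.exp ((-(l ^ 2 * w / 2) : ℝ)) - (1 - ((l ^ 2 * w / 2 : ℝ) : ℂ)))‖ := by
        congr 1; push_cast; ring
    _ ≤ _ := norm_sub_le _ _
    _ ≤ η * (l * d) ^ 2 + η * (l ^ 2 * w) := add_le_add a1 a2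
    _ = _ := by ring

lemma orth {m : MeasurableSpace Ω} (hm : m ≤ m0) {W : Ω → ℂ} {Y : Ω → ℝ} {A : ℝ}
    (hW : StronglyMeasurable[m] W) (hb : ∀ᵐ ω ∂μ, ‖W ω‖ ≤ A) (hY : Integrable Y μ)
    (h0 : μ[Y | m] =ᵐ[μ] 0) : ∫ ω, W ω * (Y ω : ℂ) ∂μ = 0 := by
  have hYc : Integrable (fun ω => (Y ω : ℂ)) μ := hY.ofReal
  have hi : Integrable (fun ω => W ω * (Y ω : ℂ)) μ :=
    hYc.bdd_mul (hW.mono hm).aestronglyMeasurable hb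
  have e : (fun ω => W ω * (Y ω : ℂ)) =
      fun ω => (ContinuousLinearMap.lsmul ℝ ℝ : ℝ →L[ℝ] ℂ →L[ℝ] ℂ).flip (W ω) (Y ω) := by
    ext ω; simp [mul_comm]
  rw [← integral_condExp hm]
  rw [e] at hi ⊢
  have := condExp_bilin_of_stronglyMeasurable_left
    ((ContinuousLinearMap.lsmul ℝ ℝ : ℝ →L[ℝ] ℂ →L[ℝ] ℂ).flip) hW hi hY
  rw [integral_congr_ae this]
  rw [show (0 : ℂ) = ∫ ω, (0 : ℂ) ∂μ by simp]
  refine integral_congr_ae ?_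
  filter_upwards [h0] with ω h
  simp only [h]; simp

/-- complex exponential process -/
def CP (D v : ℕ → Ω → ℝ) (l : ℝ) (n : ℕ) (ω : Ω) : ℂ :=
  Complex.exp ((l * ∑ k ∈ Finset.range n, D k ω : ℝ) * Complex.I)
    * ((Real.exp (l ^ 2 / 2 * ∑ k ∈ Finset.range n, v k ω) : ℝ) : ℂ)

lemma CP_norm (l : ℝ) (n : ℕ) (ω : Ω) : ‖CP D v l n ω‖ = Real.exp (l ^ 2 / 2 * ∑ k ∈ Finset.range n, v k ω) := by
  rw [CP, norm_mul, Complex.norm_exp_ofReal_mul_I, one_mul, Complex.norm_real, Real.norm_eq_abs,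
    abs_of_pos (Real.exp_pos _)]

lemma CP_meas (h : BMD μ ℱ D v B) (l : ℝ) (n : ℕ) : StronglyMeasurable[ℱ n] (CP D v l n) := by
  have h1 : StronglyMeasurable[ℱ n] (fun ω => ∑ k ∈ Finset.range n, D k ω) :=
    Finset.stronglyMeasurable_fun_sum _ fun k hk =>
      (h.hD k).mono (ℱ.mono (by simp at hk; omega))
  have h2 : StronglyMeasurable[ℱ n] (fun ω => ∑ k ∈ Finset.range n, v k ω) :=
    Finset.stronglyMeasurable_fun_sum _ fun k hk =>
      (h.hv k).mono (ℱ.mono (by simp at hk; omega))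
  have hc : Continuous (fun y : ℝ × ℝ => Complex.exp ((l * y.1 : ℝ) * Complex.I)
    * ((Real.exp (l ^ 2 / 2 * y.2) : ℝ) : ℂ)) := by fun_prop
  exact hc.comp_stronglyMeasurable (h1.prodMk h2)

lemma CP_step (h : BMD μ ℱ D v B) {K l η : ℝ} {n k : ℕ} (hk : k < n) (h1 : η ≤ 1)
    (hl : |l| * B k ≤ η) (hV : ∀ᵐ ω ∂μ, ∀ n : ℕ, ∑ k ∈ Finset.range n, v k ω ≤ K * n) :
    ‖∫ ω, CP D v l (k + 1) ω ∂μ - ∫ ω, CP D v l k ω ∂μ‖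
      ≤ 2 * Real.exp (l ^ 2 / 2 * (K * n)) * η * l ^ 2 * ∫ ω, v k ω ∂μ := by
  set A := Real.exp (l ^ 2 / 2 * (K * n)) with hA
  have hA0 : 0 < A := Real.exp_pos _
  have hvnn : ∀ᵐ ω ∂μ, ∀ k, 0 ≤ v k ω := ae_all_iff.2 h.vnn
  have hle : ∀ j ≤ n, ∀ᵐ ω ∂μ, Real.exp (l ^ 2 / 2 * ∑ k ∈ Finset.range j, v k ω) ≤ A := by
    intro j hj
    filter_upwards [hvnn, hV] with ω w1 w2
    refine Real.exp_le_exp.2 ?_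
    gcongr
    refine le_trans ?_ (w2 n)
    exact Finset.sum_le_sum_of_subset_of_nonneg (Finset.range_subset_range.2 hj) fun k _ _ => w1 k
  have hitg : ∀ j ≤ n, Integrable (CP D v l j) μ := fun j hj => by
    refine Integrable.of_bound ((h.CP_meas l j).mono (ℱ.le _)).aestronglyMeasurable A ?_
    filter_upwards [hle j hj] with ω w
    rw [CP_norm]; exact w
  set W : Ω → ℂ := fun ω => CP D v l k ω * ((Real.exp (l ^ 2 * v k ω / 2) : ℝ) : ℂ) with hW
  have hWm : StronglyMeasurable[ℱ k] W := by
    have hc : Continuous (fun y : ℂ × ℝ => y.1 * ((Real.exp (l ^ 2 * y.2 / 2) : ℝ) : ℂ)) := by fun_prop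
    exact hc.comp_stronglyMeasurable ((h.CP_meas l k).prodMk (h.hv k))
  have hWb : ∀ᵐ ω ∂μ, ‖W ω‖ ≤ A := by
    filter_upwards [hle (k + 1) hk] with ω w
    simp only [hW]
    rw [norm_mul, CP_norm, Complex.norm_real, Real.norm_eq_abs, abs_of_pos (Real.exp_pos _),
      ← Real.exp_add]
    refine le_trans (le_of_eq ?_) w
    congr 1; rw [Finset.sum_range_succ]; ring
  have hvi : Integrable (v k) μ := (integrable_condExp (m := ℱ k)).congr (h.var k)
  have hYi : Integrable (fun ω => D k ω ^ 2 - v k ω) μ := (h.intD2 k).sub hvi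
  have hY0 : μ[fun ω => D k ω ^ 2 - v k ω | ℱ k] =ᵐ[μ] 0 := by
    have a := condExp_sub (h.intD2 k) hvi (ℱ k)
    have b := condExp_of_stronglyMeasurable (ℱ.le k) (h.hv k) hvi
    filter_upwards [a, h.var k] with ω w1 w2
    have : (fun ω => D k ω ^ 2 - v k ω) = (fun ω => D k ω ^ 2) - v k := rfl
    rw [this, w1, Pi.sub_apply, w2, b]; simp
  have o1 := orth (ℱ.le k) hWm hWb (h.intD k) (h.mean k)
  have o2 := orth (ℱ.le k) hWm hWb hYi hY0
  have i1 : Integrable (fun ω => W ω * (D k ω : ℂ)) μ :=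
    (h.intD k).ofReal.bdd_mul (hWm.mono (ℱ.le _)).aestronglyMeasurable hWb
  have i2 : Integrable (fun ω => W ω * ((D k ω ^ 2 - v k ω : ℝ) : ℂ)) μ :=
    hYi.ofReal.bdd_mul (hWm.mono (ℱ.le _)).aestronglyMeasurable hWb
  have i3 : Integrable (fun ω => CP D v l (k + 1) ω - CP D v l k ω) μ := (hitg _ hk).sub (hitg _ hk.le)
  have key : ∫ ω, CP D v l (k + 1) ω ∂μ - ∫ ω, CP D v l k ω ∂μ =
      ∫ ω, (CP D v l (k + 1) ω - CP D v l k ω - ((l * Complex.I) * (W ω * (D k ω : ℂ))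
        - ((l ^ 2 / 2 : ℝ) : ℂ) * (W ω * ((D k ω ^ 2 - v k ω : ℝ) : ℂ)))) ∂μ := by
    have i4 : Integrable (fun ω => (l * Complex.I) * (W ω * (D k ω : ℂ))
        - ((l ^ 2 / 2 : ℝ) : ℂ) * (W ω * ((D k ω ^ 2 - v k ω : ℝ) : ℂ))) μ :=
      (i1.const_mul _).sub (i2.const_mul _)
    rw [integral_sub i3 i4,
      integral_sub (i1.const_mul _) (i2.const_mul _), integral_const_mul, integral_const_mul, o1, o2,
      integral_sub (hitg _ hk) (hitg _ hk.le)]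
    simp
  rw [key]
  have hg : Integrable (fun ω => A * (η * l ^ 2 * (D k ω ^ 2 + v k ω))) μ :=
    (((h.intD2 k).add hvi).const_mul _).const_mul _
  refine (norm_integral_le_of_norm_le hg ?_).trans (le_of_eq ?_)
  · filter_upwards [h.bdd k, h.vnn k, h.vle k, hWb] with ω w1 w2 w3 w4
    have hB0 : 0 ≤ B k := (abs_nonneg _).trans w1
    have c1 : |l * D k ω| ≤ η := by
      rw [abs_mul]; exact le_trans (by gcongr) hl
    have c2 : l ^ 2 * v k ω ≤ η ^ 2 := by
      calc l ^ 2 * v k ω ≤ |l| ^ 2 * B k ^ 2 := by rw [sq_abs]; gcongr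
        _ = (|l| * B k) ^ 2 := by ring
        _ ≤ η ^ 2 := by gcongr
    have hp := cpoint h1 c1 w2 c2
    have e : CP D v l (k + 1) ω - CP D v l k ω - ((l * Complex.I) * (W ω * (D k ω : ℂ))
        - ((l ^ 2 / 2 : ℝ) : ℂ) * (W ω * ((D k ω ^ 2 - v k ω : ℝ) : ℂ)))
        = W ω * (Complex.exp ((l * D k ω : ℝ) * Complex.I) - Complex.exp ((-(l ^ 2 * v k ω / 2) : ℝ))
      - ((l * D k ω : ℝ) * Complex.I - ((l ^ 2 / 2 * (D k ω ^ 2 - v k ω) : ℝ) : ℂ))) := by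
      have e1 : CP D v l (k + 1) ω = W ω * Complex.exp ((l * D k ω : ℝ) * Complex.I) := by
        simp only [hW, CP]
        rw [Finset.sum_range_succ, Finset.sum_range_succ, mul_add, mul_add, Real.exp_add]
        rw [show l ^ 2 / 2 * v k ω = l ^ 2 * v k ω / 2 by ring]
        push_cast
        rw [add_mul, Complex.exp_add]; ring
      have e2 : CP D v l k ω = W ω * Complex.exp ((-(l ^ 2 * v k ω / 2) : ℝ)) := by
        simp only [hW]
        rw [mul_assoc, ← Complex.ofReal_exp, ← Complex.ofReal_mul, ← Real.exp_add]
        simp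
      rw [e1, e2]; push_cast; ring
    rw [e, norm_mul]
    gcongr
  · have e3 : ∫ ω, D k ω ^ 2 ∂μ = ∫ ω, v k ω ∂μ := by
      rw [← integral_condExp (ℱ.le k)]; exact integral_congr_ae (h.var k)
    rw [integral_const_mul, integral_const_mul, integral_add (h.intD2 k) hvi, e3]; ring

lemma CP_total (h : BMD μ ℱ D v B) {K l η : ℝ} {n : ℕ} (h1 : η ≤ 1) (hη : 0 ≤ η)
    (hl : ∀ k < n, |l| * B k ≤ η) (hV : ∀ᵐ ω ∂μ, ∀ n : ℕ, ∑ k ∈ Finset.range n, v k ω ≤ K * n) :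
    ‖∫ ω, CP D v l n ω ∂μ - 1‖
      ≤ 2 * Real.exp (l ^ 2 / 2 * (K * n)) * η * l ^ 2 * (K * n) := by
  have hvi : ∀ k, Integrable (v k) μ := fun k => (integrable_condExp (m := ℱ k)).congr (h.var k)
  have h0 : ∫ ω, CP D v l 0 ω ∂μ = 1 := by simp [CP]
  have tel : ∫ ω, CP D v l n ω ∂μ - 1
      = ∑ k ∈ Finset.range n, (∫ ω, CP D v l (k + 1) ω ∂μ - ∫ ω, CP D v l k ω ∂μ) := by
    rw [Finset.sum_range_sub (fun k => ∫ ω, CP D v l k ω ∂μ), h0]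
  rw [tel]
  calc _ ≤ ∑ k ∈ Finset.range n, 2 * Real.exp (l ^ 2 / 2 * (K * n)) * η * l ^ 2 * ∫ ω, v k ω ∂μ :=
        norm_sum_le_of_le _ fun k hk => h.CP_step (Finset.mem_range.1 hk) h1 (hl k (Finset.mem_range.1 hk)) hV
    _ = 2 * Real.exp (l ^ 2 / 2 * (K * n)) * η * l ^ 2 * ∫ ω, ∑ k ∈ Finset.range n, v k ω ∂μ := by
        rw [integral_finsetSum _ fun k _ => hvi k, Finset.mul_sum]
    _ ≤ _ := by
        gcongr
        calc ∫ ω, ∑ k ∈ Finset.range n, v k ω ∂μ ≤ ∫ ω, K * n ∂μ := by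
              refine integral_mono_ae (integrable_finsetSum _ fun k _ => hvi k) (integrable_const _) ?_
              filter_upwards [hV] with ω w using w n
          _ = _ := by simp

theorem clt (h : BMD μ ℱ D v B) {c β K : ℝ} (hc : 0 ≤ c) (hβ0 : 0 ≤ β) (hβ : β < 1 / 2)
    (hB : ∀ k : ℕ, B k ≤ c * ((k : ℝ) + 1) ^ β)
    (hV : ∀ᵐ ω ∂μ, ∀ n : ℕ, ∑ k ∈ Finset.range n, v k ω ≤ K * n)
    (hVl : ∀ᵐ ω ∂μ, Tendsto (fun n : ℕ => (∑ k ∈ Finset.range n, v k ω) / (n : ℝ)) atTop (𝓝 1))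
    (t : ℝ) :
    Tendsto (fun n : ℕ => ∫ ω, Complex.exp ((t * ((∑ k ∈ Finset.range n, D k ω) / Real.sqrt n) : ℝ) * Complex.I) ∂μ)
      atTop (𝓝 (Complex.exp ((-(t ^ 2 / 2) : ℝ)))) := by
  set l : ℕ → ℝ := fun n => t / Real.sqrt n with hl
  have hl2 : ∀ n : ℕ, 0 < n → l n ^ 2 * n = t ^ 2 := fun n hn => by
    have : (0 : ℝ) < n := by exact_mod_cast hn
    simp only [hl]
    rw [div_pow, Real.sq_sqrt this.le]; field_simp
  set η : ℕ → ℝ := fun n => |t| * c * (n : ℝ) ^ (β - 1 / 2) with hη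
  have hη0 : Tendsto η atTop (𝓝 0) := by
    have h1 : Tendsto (fun n : ℕ => (n : ℝ) ^ (-(1 / 2 - β))) atTop (𝓝 0) :=
      (tendsto_rpow_neg_atTop (by linarith : 0 < 1 / 2 - β)).comp tendsto_natCast_atTop_atTop
    have := h1.const_mul (|t| * c)
    simpa [hη] using this
  have hvnn : ∀ᵐ ω ∂μ, ∀ k, 0 ≤ v k ω := ae_all_iff.2 h.vnn
  -- the complex exponential process has mean tending to one
  have T1 : Tendsto (fun n : ℕ => ∫ ω, CP D v (l n) n ω ∂μ) atTop (𝓝 1) := by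
    rw [tendsto_iff_norm_sub_tendsto_zero]
    have hlim : Tendsto (fun n => 2 * Real.exp (t ^ 2 / 2 * K) * η n * (t ^ 2 * K)) atTop (𝓝 0) := by
      have := (hη0.const_mul (2 * Real.exp (t ^ 2 / 2 * K))).mul_const (t ^ 2 * K)
      simpa using this
    refine squeeze_zero' (Eventually.of_forall fun n => norm_nonneg _) ?_ hlim
    filter_upwards [eventually_gt_atTop 0, hη0.eventually (ge_mem_nhds (zero_lt_one))] with n hn hn1
    have hn0 : (0 : ℝ) < n := by exact_mod_cast hn
    have := h.CP_total (l := l n) (n := n) (η := η n) hn1 (by simp only [hη]; positivity) ?_ hV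
    · refine this.trans (le_of_eq ?_)
      rw [show l n ^ 2 / 2 * (K * n) = (l n ^ 2 * n) / 2 * K by ring, hl2 n hn,
        show ∀ a : ℝ, a * l n ^ 2 * (K * n) = a * ((l n ^ 2 * n) * K) by intro a; ring, hl2 n hn]
    · intro k hk
      have hk1 : (k : ℝ) + 1 ≤ n := by exact_mod_cast hk
      calc |l n| * B k ≤ |l n| * (c * (n : ℝ) ^ β) := by
            gcongr; exact (hB k).trans (by gcongr)
        _ = η n := by
            simp only [hl, hη]
            rw [abs_div, abs_of_nonneg (Real.sqrt_nonneg _), Real.sqrt_eq_rpow, Real.rpow_sub hn0]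
            ring
  -- compare
  have T2 : Tendsto (fun n : ℕ => ∫ ω, ‖CP D v (l n) n ω - Complex.exp ((l n * ∑ k ∈ Finset.range n, D k ω : ℝ) * Complex.I)
      * ((Real.exp (t ^ 2 / 2) : ℝ) : ℂ)‖ ∂μ) atTop (𝓝 0) := by
    have : Tendsto (fun n : ℕ => ∫ ω, ‖CP D v (l n) n ω - Complex.exp ((l n * ∑ k ∈ Finset.range n, D k ω : ℝ) * Complex.I)
      * ((Real.exp (t ^ 2 / 2) : ℝ) : ℂ)‖ ∂μ) atTop (𝓝 (∫ ω, (0 : ℝ) ∂μ)) := by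
      refine tendsto_integral_filter_of_dominated_convergence
        (fun _ => Real.exp (t ^ 2 / 2 * K) + Real.exp (t ^ 2 / 2)) ?_ ?_ (integrable_const _) ?_
      · refine Eventually.of_forall fun n => AEStronglyMeasurable.norm (AEStronglyMeasurable.sub ?_ ?_)
        · exact ((h.CP_meas (l n) n).mono (ℱ.le _)).aestronglyMeasurable
        · have h1 : StronglyMeasurable (fun ω => ∑ k ∈ Finset.range n, D k ω) :=
            Finset.stronglyMeasurable_fun_sum _ fun k hk => (h.hD k).mono (ℱ.le _)
          have hc : Continuous (fun y : ℝ => Complex.exp ((l n * y : ℝ) * Complex.I) * ((Real.exp (t ^ 2 / 2) : ℝ) : ℂ)) := by fun_prop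
          exact (hc.comp_stronglyMeasurable h1).aestronglyMeasurable
      · filter_upwards [eventually_gt_atTop 0] with n hn
        filter_upwards [hV] with ω w1
        rw [norm_norm]
        refine (norm_sub_le _ _).trans (add_le_add ?_ ?_)
        · rw [CP_norm]
          refine Real.exp_le_exp.2 ?_
          calc _ ≤ l n ^ 2 / 2 * (K * n) := by gcongr; exact w1 n
            _ = (l n ^ 2 * n) / 2 * K := by ring
            _ = _ := by rw [hl2 n hn]
        · rw [norm_mul, Complex.norm_exp_ofReal_mul_I, Complex.norm_real, Real.norm_eq_abs,
            abs_of_pos (Real.exp_pos _), one_mul]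
      · filter_upwards [hVl] with ω w1
        have e : ∀ᶠ n : ℕ in atTop, |Real.exp (t ^ 2 / 2 * ((∑ k ∈ Finset.range n, v k ω) / n)) - Real.exp (t ^ 2 / 2)| =
            ‖CP D v (l n) n ω - Complex.exp ((l n * ∑ k ∈ Finset.range n, D k ω : ℝ) * Complex.I)
              * ((Real.exp (t ^ 2 / 2) : ℝ) : ℂ)‖ := by
          filter_upwards [eventually_gt_atTop 0] with n hn
          have hn0 : (n : ℝ) ≠ 0 := by positivity
          rw [CP, ← mul_sub, norm_mul, Complex.norm_exp_ofReal_mul_I, one_mul, ← Complex.ofReal_sub,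
            Complex.norm_real, Real.norm_eq_abs]
          congr 3
          rw [← hl2 n hn]; field_simp
        refine Tendsto.congr' e ?_
        have : Tendsto (fun n : ℕ => |Real.exp (t ^ 2 / 2 * ((∑ k ∈ Finset.range n, v k ω) / n)) - Real.exp (t ^ 2 / 2)|)
            atTop (𝓝 |Real.exp (t ^ 2 / 2 * 1) - Real.exp (t ^ 2 / 2)|) :=
          (((Real.continuous_exp.tendsto _).comp (w1.const_mul _)).sub_const _).abs
        simpa using this
    simpa using this
  have T3 : Tendsto (fun n : ℕ => ∫ ω, Complex.exp ((l n * ∑ k ∈ Finset.range n, D k ω : ℝ) * Complex.I)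
      * ((Real.exp (t ^ 2 / 2) : ℝ) : ℂ) ∂μ) atTop (𝓝 1) := by
    have hd : Tendsto (fun n : ℕ => ∫ ω, CP D v (l n) n ω ∂μ - ∫ ω, Complex.exp ((l n * ∑ k ∈ Finset.range n, D k ω : ℝ) * Complex.I)
      * ((Real.exp (t ^ 2 / 2) : ℝ) : ℂ) ∂μ) atTop (𝓝 0) := by
      rw [tendsto_zero_iff_norm_tendsto_zero]
      refine squeeze_zero (fun n => norm_nonneg _) (fun n => ?_) T2
      rw [← integral_sub]
      · exact norm_integral_le_integral_norm _
      · refine Integrable.of_bound ((h.CP_meas (l n) n).mono (ℱ.le _)).aestronglyMeasurable (Real.exp (l n ^ 2 / 2 * (K * n))) ?_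
        filter_upwards [hV] with ω w1
        rw [CP_norm]
        refine Real.exp_le_exp.2 ?_
        gcongr; exact w1 n
      · have h1 : StronglyMeasurable (fun ω => ∑ k ∈ Finset.range n, D k ω) :=
            Finset.stronglyMeasurable_fun_sum _ fun k hk => (h.hD k).mono (ℱ.le _)
        have hc : Continuous (fun y : ℝ => Complex.exp ((l n * y : ℝ) * Complex.I) * ((Real.exp (t ^ 2 / 2) : ℝ) : ℂ)) := by fun_prop
        refine Integrable.of_bound (hc.comp_stronglyMeasurable h1).aestronglyMeasurable (Real.exp (t ^ 2 / 2)) (ae_of_all _ fun ω => ?_)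
        rw [norm_mul, Complex.norm_exp_ofReal_mul_I, Complex.norm_real, Real.norm_eq_abs,
            abs_of_pos (Real.exp_pos _), one_mul]
    have := T1.sub hd
    simpa using this
  have T4 := T3.mul_const (Complex.exp ((-(t ^ 2 / 2) : ℝ)))
  rw [one_mul] at T4
  refine T4.congr fun n => ?_
  rw [integral_mul_const, mul_assoc, Complex.ofReal_exp, ← Complex.exp_add]
  rw [← Complex.ofReal_add, add_neg_cancel, Complex.ofReal_zero, Complex.exp_zero, mul_one]
  congr 1; ext ω
  congr 3
  simp only [hl]; ring

end BMD

namespace MDA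

lemma weights {e w : ℕ → ℝ} {C : ℝ} (hs : ∀ n : ℕ, ∑ k ∈ Finset.range n, e k ≤ C * n)
    (hw : Antitone w) (hw0 : ∀ k, 0 ≤ w k) (n : ℕ) :
    ∑ k ∈ Finset.range n, e k * w k ≤ C * ∑ k ∈ Finset.range n, w k := by
  have key : ∀ n : ℕ, (C * n - ∑ k ∈ Finset.range n, e k) * w n ≤ ∑ k ∈ Finset.range n, (C - e k) * w k := by
    intro n
    induction n with
    | zero => simp
    | succ n ih =>
      rw [Finset.sum_range_succ, Finset.sum_range_succ]
      have h1 := hs (n + 1)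
      rw [Finset.sum_range_succ] at h1
      push_cast at h1 ⊢
      have h2 : (C * (n + 1) - (∑ k ∈ Finset.range n, e k + e n)) * w (n + 1)
          ≤ (C * (n + 1) - (∑ k ∈ Finset.range n, e k + e n)) * w n :=
        mul_le_mul_of_nonneg_left (hw (Nat.le_succ n)) (by linarith)
      refine h2.trans ?_
      calc _ = (C * n - ∑ k ∈ Finset.range n, e k) * w n + (C - e n) * w n := by ring
        _ ≤ _ := by gcongr
  have h1 := key n
  have h2 : 0 ≤ (C * n - ∑ k ∈ Finset.range n, e k) * w n :=
    mul_nonneg (by linarith [hs n]) (hw0 n)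
  have e3 : ∑ k ∈ Finset.range n, (C - e k) * w k
      = C * ∑ k ∈ Finset.range n, w k - ∑ k ∈ Finset.range n, e k * w k := by
    rw [Finset.mul_sum, ← Finset.sum_sub_distrib]
    exact Finset.sum_congr rfl fun k _ => by ring
  linarith

lemma summable_weights {e : ℕ → ℝ} {C s : ℝ} (he : ∀ k, 0 ≤ e k)
    (hs : ∀ n : ℕ, ∑ k ∈ Finset.range n, e k ≤ C * n) (h1 : 1 < s) :
    Summable (fun k : ℕ => e k * ((k : ℝ) + 1) ^ (-s)) := by
  have hC : 0 ≤ C := by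
    have := hs 1
    simp at this; exact (he 0).trans this
  have hsw : Summable (fun k : ℕ => ((k : ℝ) + 1) ^ (-s)) := by
    have := (summable_nat_add_iff 1).2 (Real.summable_nat_rpow.2 (by linarith : -s < -1))
    simpa using this
  refine summable_of_sum_range_le (c := C * ∑' k : ℕ, ((k : ℝ) + 1) ^ (-s))
    (fun k => mul_nonneg (he k) (by positivity)) fun n => ?_
  refine (weights hs ?_ (fun k => by positivity) n).trans ?_
  · intro i j hij
    refine Real.rpow_le_rpow_of_nonpos (by positivity) ?_ (by linarith)
    have : (i : ℝ) ≤ j := by exact_mod_cast hij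
    linarith
  · gcongr
    exact hsw.sum_le_tsum _ fun k _ => by positivity

lemma kronecker {a : ℕ → ℝ} {s : ℝ} (hs : 0 < s) (ha : ∀ k, 0 ≤ a k)
    (hsum : Summable (fun k : ℕ => a k * ((k : ℝ) + 1) ^ (-s))) :
    Tendsto (fun n : ℕ => (∑ k ∈ Finset.range n, a k) * (n : ℝ) ^ (-s)) atTop (𝓝 0) := by
  have := tendsto_tsum_of_dominated_convergence (𝓕 := atTop)
    (f := fun (n k : ℕ) => if k < n then a k * (n : ℝ) ^ (-s) else 0) (g := fun _ => (0 : ℝ)) hsum ?_ ?_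
  · rw [tsum_zero] at this
    refine this.congr fun n => ?_
    rw [tsum_eq_sum (s := Finset.range n), Finset.sum_mul]
    · exact Finset.sum_congr rfl fun k hk => by rw [if_pos (Finset.mem_range.1 hk)]
    · intro k hk
      rw [if_neg]; simpa using hk
  · intro k
    have h1 : Tendsto (fun n : ℕ => a k * (n : ℝ) ^ (-s)) atTop (𝓝 (a k * 0)) :=
      ((tendsto_rpow_neg_atTop hs).comp tendsto_natCast_atTop_atTop).const_mul _
    rw [mul_zero] at h1
    refine h1.congr' ?_
    filter_upwards [eventually_gt_atTop k] with n hn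
    rw [if_pos hn]
  · refine Eventually.of_forall fun n k => ?_
    split_ifs with hk
    · rw [Real.norm_eq_abs, abs_of_nonneg (mul_nonneg (ha k) (by positivity))]
      refine mul_le_mul_of_nonneg_left ?_ (ha k)
      refine Real.rpow_le_rpow_of_nonpos (by positivity) ?_ (by linarith)
      exact_mod_cast hk
    · rw [norm_zero]; exact mul_nonneg (ha k) (by positivity)

variable {Ω : Type*} {m0 : MeasurableSpace Ω} {μ : Measure Ω}

lemma ae_summable {f : ℕ → Ω → ℝ} (hi : ∀ k, Integrable (f k) μ) (h0 : ∀ k ω, 0 ≤ f k ω)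
    (hs : Summable (fun k => ∫ ω, f k ω ∂μ)) : ∀ᵐ ω ∂μ, Summable (fun k => f k ω) := by
  have h1 : ∫⁻ ω, ∑' k, ENNReal.ofReal (f k ω) ∂μ ≠ ⊤ := by
    rw [lintegral_tsum fun k => (hi k).aemeasurable.ennreal_ofReal]
    have : ∀ k, ∫⁻ ω, ENNReal.ofReal (f k ω) ∂μ = ENNReal.ofReal (∫ ω, f k ω ∂μ) := fun k =>
      (ofReal_integral_eq_lintegral_ofReal (hi k) (ae_of_all _ (h0 k))).symm
    simp_rw [this]
    exact hs.tsum_ofReal_ne_top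
  have h2 := ae_lt_top' (AEMeasurable.tsum fun k => (hi k).aemeasurable.ennreal_ofReal) h1
  filter_upwards [h2] with ω hω
  have := ENNReal.summable_toReal hω.ne
  simpa [ENNReal.toReal_ofReal, h0] using this

/-- truncation -/
def trunc (c y : ℝ) : ℝ := if |y| ≤ c then y else 0

lemma trunc_meas (c : ℝ) : Measurable (trunc c) :=
  Measurable.ite (measurableSet_le (by fun_prop) measurable_const) measurable_id measurable_const

lemma trunc_abs {c : ℝ} (hc : 0 ≤ c) (y : ℝ) : |trunc c y| ≤ c := by
  unfold trunc; split_ifs with h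
  · exact h
  · simpa using hc

lemma trunc_sq (c y : ℝ) : y ^ 2 = trunc c y ^ 2 + (y - trunc c y) ^ 2 := by
  unfold trunc; split_ifs with h <;> simp

lemma tail1 {c p : ℝ} (hc : 0 < c) (hp : 2 < p) (y : ℝ) :
    |y - trunc c y| ≤ |y| ^ p * c ^ (1 - p) := by
  unfold trunc; split_ifs with h
  · simp; positivity
  · push Not at h
    rw [sub_zero]
    have hy : 0 < |y| := hc.trans h
    calc |y| = |y| ^ p * |y| ^ (1 - p) := by rw [← Real.rpow_add hy]; simp
      _ ≤ _ := by
        refine mul_le_mul_of_nonneg_left ?_ (by positivity)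
        exact Real.rpow_le_rpow_of_nonpos hc h.le (by linarith)

lemma tail2 {c p : ℝ} (hc : 0 < c) (hp : 2 < p) (y : ℝ) :
    (y - trunc c y) ^ 2 ≤ |y| ^ p * c ^ (2 - p) := by
  unfold trunc; split_ifs with h
  · simp; positivity
  · push Not at h
    rw [sub_zero]
    have hy : 0 < |y| := hc.trans h
    calc y ^ 2 = |y| ^ (2 : ℝ) := by rw [Real.rpow_two, sq_abs]
      _ = |y| ^ p * |y| ^ (2 - p) := by rw [← Real.rpow_add hy]; simp
      _ ≤ _ := by
        refine mul_le_mul_of_nonneg_left ?_ (by positivity)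
        exact Real.rpow_le_rpow_of_nonpos hc h.le (by linarith)

lemma int_of_rpow [IsProbabilityMeasure μ] {Y : Ω → ℝ} {p : ℝ} (hp : 2 < p) (hY : AEStronglyMeasurable Y μ)
    (hi : Integrable (fun ω => |Y ω| ^ p) μ) : Integrable Y μ ∧ Integrable (fun ω => Y ω ^ 2) μ := by
  have hb : Integrable (fun ω => 1 + |Y ω| ^ p) μ := (integrable_const 1).add hi
  constructor
  · refine hb.mono' hY (ae_of_all _ fun ω => ?_)
    rw [Real.norm_eq_abs]
    rcases le_total |Y ω| 1 with h | h
    · have : 0 ≤ |Y ω| ^ p := by positivity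
      linarith
    · have := Real.rpow_le_rpow_of_exponent_le h (by linarith : 1 ≤ p)
      rw [Real.rpow_one] at this; linarith
  · refine hb.mono' (hY.pow 2) (ae_of_all _ fun ω => ?_)
    rw [Real.norm_eq_abs, abs_pow]
    rcases le_total |Y ω| 1 with h | h
    · have : 0 ≤ |Y ω| ^ p := by positivity
      have : |Y ω| ^ 2 ≤ 1 := pow_le_one₀ (abs_nonneg _) h
      linarith
    · have := Real.rpow_le_rpow_of_exponent_le h hp.le
      rw [Real.rpow_two] at this; linarith

lemma tstep [IsProbabilityMeasure μ] {m : MeasurableSpace Ω} (hm : m ≤ m0) {Y Vv : Ω → ℝ} {p c : ℝ}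
    (hc : 0 < c) (hp : 2 < p) (hY : StronglyMeasurable[m0] Y) (hi : Integrable (fun ω => |Y ω| ^ p) μ)
    (hmean : μ[Y | m] =ᵐ[μ] 0) (hvar : μ[fun ω => Y ω ^ 2 | m] =ᵐ[μ] Vv) :
    ∃ r : Ω → ℝ, r = μ[fun ω => trunc c (Y ω) | m] ∧ (∀ᵐ ω ∂μ, |r ω| ≤ c) ∧
      Integrable r μ ∧ ∫ ω, |r ω| ∂μ ≤ (∫ ω, |Y ω| ^ p ∂μ) * c ^ (1 - p) ∧
      Integrable (fun ω => Y ω - trunc c (Y ω)) μ ∧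
      ∫ ω, |Y ω - trunc c (Y ω)| ∂μ ≤ (∫ ω, |Y ω| ^ p ∂μ) * c ^ (1 - p) ∧
      μ[fun ω => trunc c (Y ω) - r ω | m] =ᵐ[μ] 0 ∧
      Integrable (fun ω => Vv ω - (μ[fun ω => (trunc c (Y ω) - r ω) ^ 2 | m]) ω) μ ∧
      ∫ ω, |Vv ω - (μ[fun ω => (trunc c (Y ω) - r ω) ^ 2 | m]) ω| ∂μ
        ≤ 2 * ((∫ ω, |Y ω| ^ p ∂μ) * c ^ (2 - p)) := by
  obtain ⟨iY, iY2⟩ := int_of_rpow hp hY.aestronglyMeasurable hi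
  set T : Ω → ℝ := fun ω => trunc c (Y ω) with hT
  have mT : StronglyMeasurable[m0] T := ((trunc_meas c).comp hY.measurable).stronglyMeasurable
  have bT : ∀ ω, |T ω| ≤ c := fun ω => trunc_abs hc.le _
  have iT : Integrable T μ := Integrable.of_bound mT.aestronglyMeasurable c (ae_of_all _ bT)
  have iT2 : Integrable (fun ω => T ω ^ 2) μ := by
    refine Integrable.of_bound (mT.pow 2).aestronglyMeasurable (c ^ 2) (ae_of_all _ fun ω => ?_)
    rw [Real.norm_eq_abs, abs_pow]; exact pow_le_pow_left₀ (abs_nonneg _) (bT ω) 2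
  set r := μ[T | m] with hr
  have mr : StronglyMeasurable[m] r := stronglyMeasurable_condExp
  have br : ∀ᵐ ω ∂μ, |r ω| ≤ c := ae_bdd_abs_condExp_of_ae_bdd_abs (ae_of_all _ bT)
  have ir : Integrable r μ := integrable_condExp
  set E : Ω → ℝ := fun ω => Y ω - T ω with hE
  have iE : Integrable E μ := iY.sub iT
  have iE2 : Integrable (fun ω => E ω ^ 2) μ := by
    refine (iY2.sub iT2).congr (ae_of_all _ fun ω => ?_)
    have := trunc_sq c (Y ω)
    simp only [Pi.sub_apply, hE, hT]; linarith
  have bE : ∫ ω, |E ω| ∂μ ≤ (∫ ω, |Y ω| ^ p ∂μ) * c ^ (1 - p) := by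
    rw [← integral_mul_const]
    exact integral_mono iE.abs (hi.mul_const _) fun ω => tail1 hc hp _
  have bE2 : ∫ ω, E ω ^ 2 ∂μ ≤ (∫ ω, |Y ω| ^ p ∂μ) * c ^ (2 - p) := by
    rw [← integral_mul_const]
    exact integral_mono iE2 (hi.mul_const _) fun ω => tail2 hc hp _
  have rE : r =ᵐ[μ] -μ[E | m] := by
    have := condExp_sub iY iT m
    filter_upwards [this, hmean] with ω w1 w2
    have e : E = Y - T := rfl
    rw [Pi.neg_apply, e, w1, Pi.sub_apply, w2, hr]; simp
  have br1 : ∫ ω, |r ω| ∂μ ≤ (∫ ω, |Y ω| ^ p ∂μ) * c ^ (1 - p) := by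
    refine le_trans (le_of_eq ?_) ((integral_abs_condExp_le (m := m) E).trans bE)
    refine integral_congr_ae ?_
    filter_upwards [rE] with ω w
    rw [w, Pi.neg_apply, abs_neg]
  have ir2 : Integrable (fun ω => r ω ^ 2) μ := by
    refine Integrable.of_bound ((mr.mono hm).pow 2).aestronglyMeasurable (c ^ 2) ?_
    filter_upwards [br] with ω w
    rw [Real.norm_eq_abs, abs_pow]; exact pow_le_pow_left₀ (abs_nonneg _) w 2
  have irT : Integrable (r * T) μ := iT.bdd_mul (mr.mono hm).aestronglyMeasurable br
  have z1 : μ[fun ω => T ω - r ω | m] =ᵐ[μ] 0 := by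
    have := condExp_sub iT ir m
    filter_upwards [this] with ω w1
    have e : (fun ω => T ω - r ω) = T - r := rfl
    rw [e, w1, Pi.sub_apply, condExp_of_stronglyMeasurable hm mr ir]; simp [hr]
  have z2 : μ[fun ω => (T ω - r ω) ^ 2 | m] =ᵐ[μ] fun ω => (μ[fun ω => T ω ^ 2 | m]) ω - r ω ^ 2 := by
    have e : (fun ω => (T ω - r ω) ^ 2) = ((fun ω => T ω ^ 2) - (2 : ℝ) • (r * T)) + (fun ω => r ω ^ 2) := by
      ext ω; simp; ring
    have a1 := condExp_add (m := m) (iT2.sub (irT.smul (2 : ℝ))) ir2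
    have a2 := condExp_sub iT2 (irT.smul (2 : ℝ)) m
    have a3 := condExp_smul (μ := μ) (2 : ℝ) (r * T) m
    have a4 := condExp_mul_of_stronglyMeasurable_left mr irT iT
    have a5 := condExp_of_stronglyMeasurable hm (mr.pow 2) ir2
    filter_upwards [a1, a2, a3, a4] with ω w1 w2 w3 w4
    rw [e, w1, Pi.add_apply, w2, Pi.sub_apply, w3, Pi.smul_apply, w4, Pi.mul_apply, ← hr]
    have a6 : (μ[fun ω => r ω ^ 2 | m]) ω = r ω ^ 2 := congrFun a5 ω
    rw [a6, smul_eq_mul]; ring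
  have z3 : (fun ω => Vv ω - (μ[fun ω => (T ω - r ω) ^ 2 | m]) ω) =ᵐ[μ]
      fun ω => (μ[fun ω => E ω ^ 2 | m]) ω + r ω ^ 2 := by
    have a1 := condExp_add (m := m) iT2 iE2
    filter_upwards [a1, z2, hvar] with ω w1 w2 w3
    have e : (fun ω => Y ω ^ 2) = (fun ω => T ω ^ 2) + (fun ω => E ω ^ 2) := by
      ext ω; exact trunc_sq c (Y ω)
    rw [e, w1, Pi.add_apply] at w3
    rw [w2, ← w3]; ring
  have iz : Integrable (fun ω => (μ[fun ω => E ω ^ 2 | m]) ω + r ω ^ 2) μ := integrable_condExp.add ir2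
  refine ⟨r, rfl, br, ir, br1, iE, bE, z1, iz.congr z3.symm, ?_⟩
  have z4 : ∫ ω, r ω ^ 2 ∂μ ≤ (∫ ω, |Y ω| ^ p ∂μ) * c ^ (2 - p) := by
    calc ∫ ω, r ω ^ 2 ∂μ ≤ ∫ ω, c * |r ω| ∂μ := by
          refine integral_mono_ae ir2 (ir.abs.const_mul _) ?_
          filter_upwards [br] with ω w
          rw [← sq_abs, sq]
          gcongr
      _ = c * ∫ ω, |r ω| ∂μ := integral_const_mul _ _
      _ ≤ c * ((∫ ω, |Y ω| ^ p ∂μ) * c ^ (1 - p)) := by gcongr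
      _ = (∫ ω, |Y ω| ^ p ∂μ) * (c ^ (1 : ℝ) * c ^ (1 - p)) := by rw [Real.rpow_one]; ring
      _ = _ := by rw [← Real.rpow_add hc]; ring_nf
  have z5 : ∀ᵐ ω ∂μ, 0 ≤ (μ[fun ω => E ω ^ 2 | m]) ω := condExp_nonneg (ae_of_all _ fun ω => sq_nonneg _)
  calc _ = ∫ ω, (μ[fun ω => E ω ^ 2 | m]) ω + r ω ^ 2 ∂μ := by
        refine integral_congr_ae ?_
        filter_upwards [z3, z5] with ω w1 w2
        rw [w1, abs_of_nonneg (by positivity)]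
    _ = ∫ ω, E ω ^ 2 ∂μ + ∫ ω, r ω ^ 2 ∂μ := by
        rw [integral_add integrable_condExp ir2, integral_condExp hm]
    _ ≤ _ := by linarith

end MDA

/-- Martingale differences with moment bounds and converging normalized conditional variance. -/
structure MDA {Ω : Type*} {m0 : MeasurableSpace Ω} (μ : Measure Ω) (ℱ : Filtration ℕ m0)
    (D V : ℕ → Ω → ℝ) (p C : ℝ) : Prop where
  hD : ∀ k, StronglyMeasurable[ℱ (k+1)] (D k)
  int : ∀ k, Integrable (fun ω => |D k ω| ^ p) μ
  mom : ∀ n : ℕ, ∑ k ∈ Finset.range n, ∫ ω, |D k ω| ^ p ∂μ ≤ C * n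
  mean : ∀ k, μ[D k | ℱ k] =ᵐ[μ] 0
  var : ∀ k, μ[fun ω => D k ω ^ 2 | ℱ k] =ᵐ[μ] V k
  lim : ∀ᵐ ω ∂μ, Tendsto (fun n : ℕ => (∑ k ∈ Finset.range n, V k ω) / (n : ℝ)) atTop (𝓝 1)

namespace MDA

variable {Ω : Type*} {m0 : MeasurableSpace Ω} {μ : Measure Ω} [IsProbabilityMeasure μ]
  {ℱ : Filtration ℕ m0} {D V : ℕ → Ω → ℝ} {p C : ℝ}

lemma ev_const {a b : ℕ → ℝ} (h : ∀ᶠ k in atTop, a k = b k) :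
    ∃ c : ℝ, ∀ᶠ n in atTop, ∑ k ∈ Finset.range n, a k = ∑ k ∈ Finset.range n, b k + c := by
  obtain ⟨N, hN⟩ := eventually_atTop.1 h
  refine ⟨∑ k ∈ Finset.range N, a k - ∑ k ∈ Finset.range N, b k, ?_⟩
  filter_upwards [eventually_ge_atTop N] with n hn
  rw [← Finset.sum_range_add_sum_Ico a hn, ← Finset.sum_range_add_sum_Ico b hn]
  rw [Finset.sum_congr rfl fun k hk => hN k (Finset.mem_Ico.1 hk).1]
  ring

/-- masked sums stay below the threshold -/
lemma mask_le {a T : ℕ → ℝ} (ha : ∀ k, 0 ≤ a k) (hT : Monotone T) (hT0 : 0 ≤ T 0) (n : ℕ) :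
    ∑ k ∈ Finset.range n, (if ∑ j ∈ Finset.range (k + 1), a j ≤ T (k + 1) then (1 : ℝ) else 0) * a k ≤ T n := by
  induction n with
  | zero => simpa using hT0
  | succ n ih =>
    by_cases h : ∑ j ∈ Finset.range (n + 1), a j ≤ T (n + 1)
    · refine le_trans (Finset.sum_le_sum fun k _ => ?_) h
      split_ifs
      · rw [one_mul]
      · rw [zero_mul]; exact ha k
    · rw [Finset.sum_range_succ, if_neg h, zero_mul, add_zero]
      exact ih.trans (hT (Nat.le_succ n))

theorem reduce (h : MDA μ ℱ D V p C) (hp : 2 < p) {ε : ℝ} (hε : 0 < ε) :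
    ∃ (D' v' : ℕ → Ω → ℝ) (B : ℕ → ℝ) (β : ℝ), BMD μ ℱ D' v' B ∧ 0 ≤ β ∧ β < 1 / 2 ∧
      (∀ k : ℕ, B k ≤ 2 * ((k : ℝ) + 1) ^ β) ∧
      (∀ᵐ ω ∂μ, ∀ n : ℕ, ∑ k ∈ Finset.range n, v' k ω ≤ (1 + ε) * n) ∧
      (∀ᵐ ω ∂μ, Tendsto (fun n : ℕ => (∑ k ∈ Finset.range n, v' k ω) / (n : ℝ)) atTop (𝓝 1)) ∧
      (∀ᵐ ω ∂μ, Tendsto (fun n : ℕ => (∑ k ∈ Finset.range n, D k ω - ∑ k ∈ Finset.range n, D' k ω)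
        / Real.sqrt n) atTop (𝓝 0)) := by
  obtain ⟨β, hβ1, hβ2⟩ : ∃ β, 1 / p < β ∧ β < 1 / 2 :=
    exists_between (one_div_lt_one_div_of_lt (by norm_num) hp)
  have hp0 : 0 < p := by linarith
  have hβ0 : 0 < β := lt_trans (by positivity) hβ1
  have hβp : 1 < β * p := by rwa [div_lt_iff₀ hp0] at hβ1
  set c : ℕ → ℝ := fun k => ((k : ℝ) + 1) ^ β with hc
  have hc0 : ∀ k, 0 < c k := fun k => by simp only [hc]; positivity
  have hDm : ∀ k, StronglyMeasurable[m0] (D k) := fun k => (h.hD k).mono (ℱ.le _)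
  choose r hr hrb hri hr1 hEi hE1 hz hVi hV1 using fun k =>
    tstep (ℱ.le k) (hc0 k) hp (hDm k) (h.int k) (h.mean k) (h.var k)
  set e : ℕ → ℝ := fun k => ∫ ω, |D k ω| ^ p ∂μ with he
  have he0 : ∀ k, 0 ≤ e k := fun k => integral_nonneg fun ω => by positivity
  set E : ℕ → Ω → ℝ := fun k ω => D k ω - trunc (c k) (D k ω) with hE
  set Y : ℕ → Ω → ℝ := fun k ω => trunc (c k) (D k ω) - r k ω with hY
  set a : ℕ → Ω → ℝ := fun k => μ[fun ω => Y k ω ^ 2 | ℱ k] with ha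
  have mr : ∀ k, StronglyMeasurable[ℱ k] (r k) := fun k => by rw [hr k]; exact stronglyMeasurable_condExp
  have mT : ∀ k, StronglyMeasurable[ℱ (k + 1)] (fun ω => trunc (c k) (D k ω)) := fun k =>
    ((trunc_meas (c k)).comp (h.hD k).measurable).stronglyMeasurable
  have mY : ∀ k, StronglyMeasurable[ℱ (k + 1)] (Y k) := fun k =>
    (mT k).sub ((mr k).mono (ℱ.mono (Nat.le_succ k)))
  have ma : ∀ k, StronglyMeasurable[ℱ k] (a k) := fun k => stronglyMeasurable_condExp
  have ha0 : ∀ᵐ ω ∂μ, ∀ k, 0 ≤ a k ω := ae_all_iff.2 fun k =>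
    condExp_nonneg (ae_of_all _ fun ω => sq_nonneg _)
  have bY : ∀ k, ∀ᵐ ω ∂μ, |Y k ω| ≤ 2 * c k := fun k => by
    filter_upwards [hrb k] with ω w
    have := trunc_abs (hc0 k).le (D k ω)
    calc |Y k ω| ≤ |trunc (c k) (D k ω)| + |r k ω| := abs_sub _ _
      _ ≤ _ := by linarith
  have iY : ∀ k, Integrable (Y k) μ := fun k =>
    Integrable.of_bound ((mY k).mono (ℱ.le _)).aestronglyMeasurable _ (bY k)
  have iY2 : ∀ k, Integrable (fun ω => Y k ω ^ 2) μ := fun k => by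
    refine Integrable.of_bound (((mY k).mono (ℱ.le _)).pow 2).aestronglyMeasurable ((2 * c k) ^ 2) ?_
    filter_upwards [bY k] with ω w
    rw [Real.norm_eq_abs, abs_pow]; exact pow_le_pow_left₀ (abs_nonneg _) w 2
  -- almost sure summability
  have hck : ∀ (k : ℕ) (s t : ℝ), c k ^ s * ((k : ℝ) + 1) ^ t = ((k : ℝ) + 1) ^ (-(-(β * s) - t)) := fun k s t => by
    have : (0 : ℝ) < (k : ℝ) + 1 := by positivity
    simp only [hc]
    rw [← Real.rpow_mul this.le, ← Real.rpow_add this]; congr 1; ring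
  have S1 : ∀ᵐ ω ∂μ, Summable (fun k : ℕ => (|E k ω| + |r k ω|) * ((k : ℝ) + 1) ^ (-(1 / 2 : ℝ))) := by
    refine ae_summable (fun k => ((hEi k).abs.add (hri k).abs).mul_const _) (fun k ω => by positivity) ?_
    have hs := (summable_weights he0 h.mom (s := -(β * (1 - p)) - -(1 / 2)) (by nlinarith)).mul_left 2
    refine Summable.of_nonneg_of_le (fun k => integral_nonneg fun ω => by positivity) (fun k => ?_) hs
    rw [← hck, integral_mul_const, integral_add (hEi k).abs (hri k).abs]
    calc _ ≤ (2 * (e k * c k ^ (1 - p))) * ((k : ℝ) + 1) ^ (-(1 / 2 : ℝ)) := by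
          gcongr
          have := hE1 k; have := hr1 k
          linarith
      _ = _ := by ring
  have S2 : ∀ᵐ ω ∂μ, Summable (fun k : ℕ => |V k ω - a k ω| * ((k : ℝ) + 1) ^ (-(1 : ℝ))) := by
    refine ae_summable (fun k => (hVi k).abs.mul_const _) (fun k ω => by positivity) ?_
    have hs := (summable_weights he0 h.mom (s := -(β * (2 - p)) - -1) (by nlinarith)).mul_left 2
    refine Summable.of_nonneg_of_le (fun k => integral_nonneg fun ω => by positivity) (fun k => ?_) hs
    rw [← hck, integral_mul_const]
    calc _ ≤ (2 * (e k * c k ^ (2 - p))) * ((k : ℝ) + 1) ^ (-(1 : ℝ)) := by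
          gcongr
          exact hV1 k
      _ = _ := by ring
  have A1 : ∀ᵐ ω ∂μ, Tendsto (fun n : ℕ => (∑ k ∈ Finset.range n, a k ω) / (n : ℝ)) atTop (𝓝 1) := by
    filter_upwards [S2, h.lim] with ω w1 w2
    have k1 := kronecker one_pos (fun k => abs_nonneg _) w1
    have k2 : Tendsto (fun n : ℕ => (∑ k ∈ Finset.range n, (V k ω - a k ω)) / (n : ℝ)) atTop (𝓝 0) := by
      refine squeeze_zero_norm (fun n => ?_) k1
      rw [Real.norm_eq_abs, abs_div, Nat.abs_cast, Real.rpow_neg_one, ← div_eq_mul_inv]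
      gcongr
      exact Finset.abs_sum_le_sum_abs _ _
    have := w2.sub k2
    rw [sub_zero] at this
    refine this.congr fun n => ?_
    rw [← sub_div, Finset.sum_sub_distrib]; ring
  -- mask
  set I : ℕ → Ω → ℝ := fun k ω =>
    if ∑ j ∈ Finset.range (k + 1), a j ω ≤ (1 + ε) * ((k + 1 : ℕ) : ℝ) then (1 : ℝ) else 0 with hI
  have mI : ∀ k, StronglyMeasurable[ℱ k] (I k) := fun k => by
    have h1 : StronglyMeasurable[ℱ k] (fun ω => ∑ j ∈ Finset.range (k + 1), a j ω) :=
      Finset.stronglyMeasurable_fun_sum _ fun j hj => (ma j).mono (ℱ.mono (by simp at hj; omega))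
    have h2 : Measurable (fun y : ℝ => if y ≤ (1 + ε) * ((k + 1 : ℕ) : ℝ) then (1 : ℝ) else 0) :=
      Measurable.ite measurableSet_Iic measurable_const measurable_const
    exact (h2.comp h1.measurable).stronglyMeasurable
  have I01 : ∀ k ω, I k ω = 0 ∨ I k ω = 1 := fun k ω => by
    simp only [hI]; split_ifs <;> simp
  have bI : ∀ k ω, |I k ω| ≤ 1 := fun k ω => by
    rcases I01 k ω with h | h <;> rw [h] <;> simp
  have I1 : ∀ᵐ ω ∂μ, ∀ᶠ k in atTop, I k ω = 1 := by
    filter_upwards [A1] with ω w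
    have := (tendsto_add_atTop_nat 1).eventually (w.eventually (gt_mem_nhds (by linarith : 1 < 1 + ε)))
    filter_upwards [this] with k hk
    simp only [hI]
    rw [if_pos]
    rw [div_lt_iff₀ (by positivity)] at hk
    exact hk.le
  refine ⟨fun k => I k * Y k, fun k => I k * a k, fun k => 2 * c k, β, ?_, hβ0.le, hβ2,
    fun k => le_rfl, ?_, ?_, ?_⟩
  · refine ⟨fun k => ((mI k).mono (ℱ.mono (Nat.le_succ k))).mul (mY k), fun k => (mI k).mul (ma k), ?_, ?_, ?_⟩
    · intro k
      filter_upwards [bY k] with ω w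
      rw [Pi.mul_apply, abs_mul]
      calc _ ≤ 1 * |Y k ω| := by gcongr; exact bI k ω
        _ ≤ _ := by linarith
    · intro k
      have h1 := condExp_mul_of_stronglyMeasurable_left (mI k)
        ((iY k).bdd_mul ((mI k).mono (ℱ.le _)).aestronglyMeasurable (ae_of_all _ (bI k))) (iY k)
      filter_upwards [h1, hz k] with ω w1 w2
      rw [w1, Pi.mul_apply]
      have w3 : (μ[Y k | ℱ k]) ω = 0 := w2
      rw [w3]; simp
    · intro k
      have h1 := condExp_mul_of_stronglyMeasurable_left (mI k)
        ((iY2 k).bdd_mul ((mI k).mono (ℱ.le _)).aestronglyMeasurable (ae_of_all _ (bI k))) (iY2 k)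
      have e1 : (fun ω => (I k * Y k) ω ^ 2) = I k * (fun ω => Y k ω ^ 2) := by
        ext ω
        rw [Pi.mul_apply, Pi.mul_apply, mul_pow]
        rcases I01 k ω with h | h <;> rw [h] <;> simp
      rw [e1]; exact h1
  · filter_upwards [ha0] with ω w n
    exact mask_le (T := fun n : ℕ => (1 + ε) * (n : ℝ)) w
      (fun i j hij => by
        have : (i : ℝ) ≤ j := by exact_mod_cast hij
        dsimp only; gcongr) (by simp) n
  · filter_upwards [A1, I1] with ω w1 w2
    obtain ⟨C', hC'⟩ := ev_const (a := fun k => (I k * a k) ω) (b := fun k => a k ω)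
      (w2.mono fun k hk => by rw [Pi.mul_apply, hk, one_mul])
    have h1 : Tendsto (fun n : ℕ => (∑ k ∈ Finset.range n, a k ω) / (n : ℝ) + C' / n) atTop (𝓝 (1 + 0)) :=
      w1.add (tendsto_const_div_atTop_nhds_zero_nat C')
    rw [add_zero] at h1
    refine h1.congr' ?_
    filter_upwards [hC'] with n hn
    rw [hn]; ring
  · filter_upwards [S1, I1] with ω w1 w2
    have k1 := kronecker (by norm_num) (fun k => by positivity) w1
    have hsq : ∀ n : ℕ, (n : ℝ) ^ (-(1 / 2 : ℝ)) = (Real.sqrt n)⁻¹ := fun n => by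
      rw [Real.rpow_neg (by positivity), Real.sqrt_eq_rpow]
    have k2 : Tendsto (fun n : ℕ => (∑ k ∈ Finset.range n, (E k ω + r k ω)) / Real.sqrt n) atTop (𝓝 0) := by
      refine squeeze_zero_norm (fun n => ?_) k1
      rw [Real.norm_eq_abs, abs_div, abs_of_nonneg (Real.sqrt_nonneg _), hsq, ← div_eq_mul_inv]
      gcongr
      refine (Finset.abs_sum_le_sum_abs _ _).trans (Finset.sum_le_sum fun k _ => abs_add_le _ _)
    obtain ⟨C', hC'⟩ := ev_const (a := fun k => D k ω - (I k * Y k) ω) (b := fun k => E k ω + r k ω)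
      (w2.mono fun k hk => by rw [Pi.mul_apply, hk, one_mul]; simp only [hE, hY]; ring)
    have h0 : Tendsto (fun n : ℕ => C' / Real.sqrt n) atTop (𝓝 0) :=
      tendsto_const_nhds.div_atTop (Real.tendsto_sqrt_atTop.comp tendsto_natCast_atTop_atTop)
    have h1 := k2.add h0
    rw [add_zero] at h1
    refine h1.congr' ?_
    filter_upwards [hC'] with n hn
    rw [← Finset.sum_sub_distrib, hn]; ring

end MDA

namespace MDA

variable {Ω : Type*} {m0 : MeasurableSpace Ω} {μ : Measure Ω} [IsProbabilityMeasure μ]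
  {ℱ : Filtration ℕ m0} {D V : ℕ → Ω → ℝ} {p C : ℝ}

theorem clt (h : MDA μ ℱ D V p C) (hp : 2 < p) (t : ℝ) :
    Tendsto (fun n : ℕ => ∫ ω, Complex.exp ((t * ((∑ k ∈ Finset.range n, D k ω) / Real.sqrt n) : ℝ) * Complex.I) ∂μ)
      atTop (𝓝 (Complex.exp ((-(t ^ 2 / 2) : ℝ)))) := by
  obtain ⟨D', v', B, β, hb, hβ0, hβ, hB, hV, hVl, hd⟩ := h.reduce hp (one_pos)
  have h1 := hb.clt (by norm_num) hβ0 hβ hB hV hVl t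
  have mD : ∀ n : ℕ, StronglyMeasurable (fun ω => ∑ k ∈ Finset.range n, D k ω) := fun n =>
    Finset.stronglyMeasurable_fun_sum _ fun k _ => (h.hD k).mono (ℱ.le _)
  have mD' : ∀ n : ℕ, StronglyMeasurable (fun ω => ∑ k ∈ Finset.range n, D' k ω) := fun n =>
    Finset.stronglyMeasurable_fun_sum _ fun k _ => (hb.hD k).mono (ℱ.le _)
  have hc : ∀ n : ℕ, Continuous (fun y : ℝ => Complex.exp ((t * (y / Real.sqrt n) : ℝ) * Complex.I)) := fun n => by
    have : (fun y : ℝ => Complex.exp ((t * (y / Real.sqrt n) : ℝ) * Complex.I))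
      = fun y : ℝ => Complex.exp ((t * (y * (Real.sqrt n)⁻¹) : ℝ) * Complex.I) := by
        ext y; rw [div_eq_mul_inv]
    rw [this]; fun_prop
  have iD : ∀ n : ℕ, Integrable (fun ω => Complex.exp ((t * ((∑ k ∈ Finset.range n, D k ω) / Real.sqrt n) : ℝ) * Complex.I)) μ :=
    fun n => Integrable.of_bound ((hc n).comp_stronglyMeasurable (mD n)).aestronglyMeasurable 1
      (ae_of_all _ fun ω => by rw [Complex.norm_exp_ofReal_mul_I])
  have iD' : ∀ n : ℕ, Integrable (fun ω => Complex.exp ((t * ((∑ k ∈ Finset.range n, D' k ω) / Real.sqrt n) : ℝ) * Complex.I)) μ :=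
    fun n => Integrable.of_bound ((hc n).comp_stronglyMeasurable (mD' n)).aestronglyMeasurable 1
      (ae_of_all _ fun ω => by rw [Complex.norm_exp_ofReal_mul_I])
  have T : Tendsto (fun n : ℕ => ∫ ω, ‖Complex.exp ((t * ((∑ k ∈ Finset.range n, D k ω) / Real.sqrt n) : ℝ) * Complex.I)
      - Complex.exp ((t * ((∑ k ∈ Finset.range n, D' k ω) / Real.sqrt n) : ℝ) * Complex.I)‖ ∂μ) atTop (𝓝 (∫ ω, (0 : ℝ) ∂μ)) := by
    refine tendsto_integral_filter_of_dominated_convergence (fun _ => 2)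
      (Eventually.of_forall fun n => ((iD n).sub (iD' n)).aestronglyMeasurable.norm) ?_ (integrable_const _) ?_
    · refine Eventually.of_forall fun n => ae_of_all _ fun ω => ?_
      rw [norm_norm]
      refine (norm_sub_le _ _).trans ?_
      rw [Complex.norm_exp_ofReal_mul_I, Complex.norm_exp_ofReal_mul_I]; norm_num
    · filter_upwards [hd] with ω w
      have e : ∀ n : ℕ, ‖Complex.exp ((t * ((∑ k ∈ Finset.range n, D k ω - ∑ k ∈ Finset.range n, D' k ω) / Real.sqrt n) : ℝ) * Complex.I) - 1‖
          = ‖Complex.exp ((t * ((∑ k ∈ Finset.range n, D k ω) / Real.sqrt n) : ℝ) * Complex.I)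
      - Complex.exp ((t * ((∑ k ∈ Finset.range n, D' k ω) / Real.sqrt n) : ℝ) * Complex.I)‖ := fun n => by
        have : Complex.exp ((t * ((∑ k ∈ Finset.range n, D k ω) / Real.sqrt n) : ℝ) * Complex.I)
          = Complex.exp ((t * ((∑ k ∈ Finset.range n, D' k ω) / Real.sqrt n) : ℝ) * Complex.I) *
            Complex.exp ((t * ((∑ k ∈ Finset.range n, D k ω - ∑ k ∈ Finset.range n, D' k ω) / Real.sqrt n) : ℝ) * Complex.I) := by
          rw [← Complex.exp_add, ← add_mul, ← Complex.ofReal_add]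
          congr 3; ring
        rw [this]
        rw [show ∀ a b : ℂ, a * b - a = a * (b - 1) by intro a b; ring, norm_mul, Complex.norm_exp_ofReal_mul_I, one_mul]
      refine Tendsto.congr e ?_
      have hcc : Continuous (fun y : ℝ => ‖Complex.exp ((t * y : ℝ) * Complex.I) - 1‖) := by fun_prop
      have := (hcc.tendsto 0).comp w
      have e0 : ‖Complex.exp ((t * 0 : ℝ) * Complex.I) - 1‖ = 0 := by simp
      rw [e0] at this
      exact this
  have hdiff : Tendsto (fun n : ℕ => ∫ ω, Complex.exp ((t * ((∑ k ∈ Finset.range n, D k ω) / Real.sqrt n) : ℝ) * Complex.I) ∂μ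
      - ∫ ω, Complex.exp ((t * ((∑ k ∈ Finset.range n, D' k ω) / Real.sqrt n) : ℝ) * Complex.I) ∂μ) atTop (𝓝 0) := by
    rw [tendsto_zero_iff_norm_tendsto_zero]
    rw [integral_zero] at T
    refine squeeze_zero (fun n => norm_nonneg _) (fun n => ?_) T
    rw [← integral_sub (iD n) (iD' n)]
    exact norm_integral_le_integral_norm _
  have := hdiff.add h1
  simpa using this

lemma sqrt_le_LL : ∀ᶠ n : ℕ in atTop, Real.sqrt n ≤ LL n := by
  have h1 : Tendsto (fun n : ℕ => Real.log (Real.log n)) atTop atTop :=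
    Real.tendsto_log_atTop.comp (Real.tendsto_log_atTop.comp tendsto_natCast_atTop_atTop)
  filter_upwards [h1.eventually_ge_atTop 1] with n hn
  refine Real.sqrt_le_sqrt ?_
  have : (0 : ℝ) ≤ n := by positivity
  nlinarith

lemma LL_pos : ∀ᶠ n : ℕ in atTop, 0 < LL n := by
  filter_upwards [sqrt_le_LL, eventually_gt_atTop 0] with n hn hn0
  have : (0 : ℝ) < n := by exact_mod_cast hn0
  exact lt_of_lt_of_le (Real.sqrt_pos.2 this) hn

lemma small_diff {a : ℕ → ℝ} (ha : Tendsto (fun n : ℕ => a n / Real.sqrt n) atTop (𝓝 0)) {δ : ℝ} (hδ : 0 < δ) :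
    ∀ᶠ n : ℕ in atTop, |a n| ≤ δ * LL n := by
  have h1 := ha.abs
  rw [abs_zero] at h1
  filter_upwards [h1.eventually (gt_mem_nhds hδ), sqrt_le_LL, eventually_gt_atTop 0] with n hn h2 hn0
  have h3 : 0 < Real.sqrt n := Real.sqrt_pos.2 (by exact_mod_cast hn0)
  rw [abs_div, abs_of_pos h3, div_lt_iff₀ h3] at hn
  refine hn.le.trans ?_
  gcongr

theorem up (h : MDA μ ℱ D V p C) (hp : 2 < p) {ε : ℝ} (hε : 0 < ε) :
    ∀ᵐ ω ∂μ, ∀ᶠ n : ℕ in atTop, ∑ k ∈ Finset.range n, D k ω ≤ (1 + ε) * LL n := by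
  obtain ⟨D', v', B, β, hb, hβ0, hβ, hB, hV, hVl, hd⟩ := h.reduce hp (half_pos hε)
  have h1 := hb.upper (κ := 1 + ε / 2) (by norm_num) hβ0 hβ hB (by positivity) hV (by positivity) (by nlinarith)
  filter_upwards [h1, hd] with ω w1 w2
  filter_upwards [w1, small_diff w2 (half_pos hε)] with n hn1 hn2
  have := (abs_le.1 hn2).2
  linarith

theorem low (h : MDA μ ℱ D V p C) (hp : 2 < p) {ε : ℝ} (hε : 0 < ε) :
    ∀ᵐ ω ∂μ, ∃ᶠ n : ℕ in atTop, (1 - ε) * LL n ≤ ∑ k ∈ Finset.range n, D k ω := by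
  have he : 0 < min (1 / 2) (ε / 26) := lt_min (by norm_num) (by positivity)
  obtain ⟨D', v', B, β, hb, hβ0, hβ, hB, hV, hVl, hd⟩ := h.reduce hp he
  have h1 := hb.lower (by norm_num) hβ0 hβ hB he (min_le_left _ _) hV hVl
  filter_upwards [h1, hd] with ω w1 w2
  refine (w1.and_eventually (small_diff w2 (half_pos hε))).mono ?_
  rintro n ⟨hn1, hn2⟩
  have h3 := (abs_le.1 hn2).1
  have h4 : (1 - ε / 2) * LL n ≤ (1 - 13 * min (1 / 2) (ε / 26)) * LL n := by
    have := LL_nonneg n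
    gcongr
    linarith [min_le_right (1 / 2) (ε / 26)]
  linarith

lemma neg (h : MDA μ ℱ D V p C) : MDA μ ℱ (fun k ω => - D k ω) V p C where
  hD k := (h.hD k).neg
  int k := by simpa using h.int k
  mom n := by simpa using h.mom n
  mean k := by
    have := condExp_neg (μ := μ) (D k) (ℱ k)
    filter_upwards [this, h.mean k] with ω h1 h2
    have h3 : (fun ω => - D k ω) = - D k := rfl
    rw [h3, h1, Pi.neg_apply, h2]; simp
  var k := by simpa using h.var k
  lim := h.lim

lemma det_limsup {a : ℕ → ℝ} (h1 : ∀ m : ℕ, ∀ᶠ n in atTop, a n ≤ (1 + 1 / ((m : ℝ) + 1)))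
    (h2 : ∀ m : ℕ, ∃ᶠ n in atTop, (1 - 1 / ((m : ℝ) + 1)) ≤ a n) (h3 : ∀ᶠ n in atTop, -2 ≤ a n) :
    limsup a atTop = 1 := by
  have b1 : IsBoundedUnder (· ≤ ·) atTop a := ⟨_, eventually_map.2 (h1 0)⟩
  have b2 : IsCoboundedUnder (· ≤ ·) atTop a :=
    IsBoundedUnder.isCoboundedUnder_le ⟨-2, eventually_map.2 h3⟩
  have t1 : Tendsto (fun m : ℕ => 1 + 1 / ((m : ℝ) + 1)) atTop (𝓝 (1 + 0)) :=
    tendsto_one_div_add_atTop_nhds_zero_nat.const_add 1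
  have t2 : Tendsto (fun m : ℕ => 1 - 1 / ((m : ℝ) + 1)) atTop (𝓝 (1 - 0)) :=
    tendsto_one_div_add_atTop_nhds_zero_nat.const_sub 1
  rw [add_zero] at t1
  rw [sub_zero] at t2
  refine le_antisymm (ge_of_tendsto' t1 fun m => limsup_le_of_le b2 (h1 m))
    (le_of_tendsto' t2 fun m => le_limsup_of_frequently_le (h2 m) b1)

lemma det_liminf {a : ℕ → ℝ} (h1 : ∀ m : ℕ, ∀ᶠ n in atTop, - a n ≤ (1 + 1 / ((m : ℝ) + 1)))
    (h2 : ∀ m : ℕ, ∃ᶠ n in atTop, (1 - 1 / ((m : ℝ) + 1)) ≤ - a n) (h3 : ∀ᶠ n in atTop, a n ≤ 2) :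
    liminf a atTop = -1 := by
  have b1 : IsBoundedUnder (· ≥ ·) atTop a :=
    ⟨-2, eventually_map.2 ((h1 0).mono fun n hn => by norm_num at hn; show -2 ≤ a n; linarith)⟩
  have b2 : IsCoboundedUnder (· ≥ ·) atTop a :=
    IsBoundedUnder.isCoboundedUnder_ge ⟨2, eventually_map.2 h3⟩
  have t1 : Tendsto (fun m : ℕ => -(1 + 1 / ((m : ℝ) + 1))) atTop (𝓝 (-(1 + 0))) :=
    (tendsto_one_div_add_atTop_nhds_zero_nat.const_add 1).neg
  have t2 : Tendsto (fun m : ℕ => -(1 - 1 / ((m : ℝ) + 1))) atTop (𝓝 (-(1 - 0))) :=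
    (tendsto_one_div_add_atTop_nhds_zero_nat.const_sub 1).neg
  rw [add_zero] at t1
  rw [sub_zero] at t2
  refine le_antisymm (ge_of_tendsto' t2 fun m => liminf_le_of_frequently_le ((h2 m).mono fun n hn => by linarith) b1)
    (le_of_tendsto' t1 fun m => le_liminf_of_le b2 ((h1 m).mono fun n hn => by linarith))

theorem lil (h : MDA μ ℱ D V p C) (hp : 2 < p) :
    ∀ᵐ ω ∂μ, limsup (fun n : ℕ => (∑ k ∈ Finset.range n, D k ω) / LL n) atTop = 1 ∧
      liminf (fun n : ℕ => (∑ k ∈ Finset.range n, D k ω) / LL n) atTop = -1 := by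
  have q1 : ∀ᵐ ω ∂μ, ∀ m : ℕ, ∀ᶠ n : ℕ in atTop, ∑ k ∈ Finset.range n, D k ω ≤ (1 + 1 / ((m : ℝ) + 1)) * LL n :=
    ae_all_iff.2 fun m => h.up hp (by positivity)
  have q2 : ∀ᵐ ω ∂μ, ∀ m : ℕ, ∃ᶠ n : ℕ in atTop, (1 - 1 / ((m : ℝ) + 1)) * LL n ≤ ∑ k ∈ Finset.range n, D k ω :=
    ae_all_iff.2 fun m => h.low hp (by positivity)
  have q3 : ∀ᵐ ω ∂μ, ∀ m : ℕ, ∀ᶠ n : ℕ in atTop, ∑ k ∈ Finset.range n, - D k ω ≤ (1 + 1 / ((m : ℝ) + 1)) * LL n :=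
    ae_all_iff.2 fun m => h.neg.up hp (by positivity)
  have q4 : ∀ᵐ ω ∂μ, ∀ m : ℕ, ∃ᶠ n : ℕ in atTop, (1 - 1 / ((m : ℝ) + 1)) * LL n ≤ ∑ k ∈ Finset.range n, - D k ω :=
    ae_all_iff.2 fun m => h.neg.low hp (by positivity)
  filter_upwards [q1, q2, q3, q4] with ω w1 w2 w3 w4
  have u1 : ∀ m : ℕ, ∀ᶠ n : ℕ in atTop, (∑ k ∈ Finset.range n, D k ω) / LL n ≤ 1 + 1 / ((m : ℝ) + 1) := fun m => by
    filter_upwards [w1 m, LL_pos] with n hn hn0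
    rwa [div_le_iff₀ hn0]
  have u2 : ∀ m : ℕ, ∃ᶠ n : ℕ in atTop, 1 - 1 / ((m : ℝ) + 1) ≤ (∑ k ∈ Finset.range n, D k ω) / LL n := fun m => by
    refine ((w2 m).and_eventually LL_pos).mono ?_
    rintro n ⟨hn, hn0⟩
    rwa [le_div_iff₀ hn0]
  have u3 : ∀ m : ℕ, ∀ᶠ n : ℕ in atTop, -((∑ k ∈ Finset.range n, D k ω) / LL n) ≤ 1 + 1 / ((m : ℝ) + 1) := fun m => by
    filter_upwards [w3 m, LL_pos] with n hn hn0
    rw [Finset.sum_neg_distrib] at hn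
    rwa [← neg_div, div_le_iff₀ hn0]
  have u4 : ∀ m : ℕ, ∃ᶠ n : ℕ in atTop, 1 - 1 / ((m : ℝ) + 1) ≤ -((∑ k ∈ Finset.range n, D k ω) / LL n) := fun m => by
    refine ((w4 m).and_eventually LL_pos).mono ?_
    rintro n ⟨hn, hn0⟩
    rw [Finset.sum_neg_distrib] at hn
    rwa [← neg_div, le_div_iff₀ hn0]
  refine ⟨det_limsup u1 u2 ?_, det_liminf u3 u4 ?_⟩
  · filter_upwards [u3 0] with n hn
    norm_num at hn; linarith
  · filter_upwards [u1 0] with n hn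
    norm_num at hn; linarith

theorem clt_weak (h : MDA μ ℱ D V p C) (hp : 2 < p) {s : ℝ} (hs : 0 < s) (F : BoundedContinuousFunction ℝ ℝ) :
    Tendsto (fun n : ℕ => ∫ ω, F ((∑ k ∈ Finset.range n, Real.sqrt s * D k ω) / Real.sqrt n) ∂μ) atTop
      (𝓝 (∫ z, F z ∂(ProbabilityTheory.gaussianReal 0 s.toNNReal))) := by
  set f : ℕ → Ω → ℝ := fun n ω => (∑ k ∈ Finset.range n, Real.sqrt s * D k ω) / Real.sqrt n with hf
  have mf : ∀ n, Measurable (f n) := fun n =>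
    (Finset.measurable_fun_sum _ fun k _ => (((h.hD k).mono (ℱ.le _)).measurable.const_mul _)).div_const _
  have pf : ∀ n, IsProbabilityMeasure (μ.map (f n)) := fun n =>
    Measure.isProbabilityMeasure_map (mf n).aemeasurable
  set ν : ℕ → ProbabilityMeasure ℝ := fun n => ⟨μ.map (f n), pf n⟩ with hν
  set γ : ProbabilityMeasure ℝ := ⟨ProbabilityTheory.gaussianReal 0 s.toNNReal, inferInstance⟩ with hγ
  have key : Tendsto ν atTop (𝓝 γ) := by
    refine ProbabilityMeasure.tendsto_of_tendsto_charFun fun t => ?_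
    have e1 : charFun (γ : Measure ℝ) t = Complex.exp ((-((t * Real.sqrt s) ^ 2 / 2) : ℝ)) := by
      change charFun (ProbabilityTheory.gaussianReal 0 s.toNNReal) t = _
      rw [ProbabilityTheory.charFun_gaussianReal]
      have e0 : ((s.toNNReal : ℝ) : ℂ) = (s : ℂ) := by rw [Real.coe_toNNReal _ hs.le]
      rw [mul_pow, Real.sq_sqrt hs.le, e0]
      congr 1; push_cast; ring
    rw [e1]
    refine (h.clt hp (t * Real.sqrt s)).congr fun n => ?_
    change _ = charFun (μ.map (f n)) t
    rw [charFun_apply_real, integral_map (mf n).aemeasurable (by fun_prop)]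
    congr 1; ext ω
    congr 1
    simp only [hf]
    rw [← Finset.mul_sum]
    push_cast; ring
  rw [ProbabilityMeasure.tendsto_iff_forall_integral_tendsto] at key
  refine (key F).congr fun n => ?_
  change ∫ z, F z ∂(μ.map (f n)) = _
  rw [integral_map (mf n).aemeasurable F.continuous.aestronglyMeasurable]

end MDA

namespace MarkovChain

lemma pf_coord {k n : ℕ} (h : k ≤ n) : Measurable[pathFiltration X n] (fun ω : ℕ → X => ω k) := by
  have h1 : Measurable[pathFiltration X n] (fun (ω : ℕ → X) (i : Fin (n + 1)) => ω (i : ℕ)) :=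
    comap_measurable _
  exact (measurable_pi_apply (⟨k, by omega⟩ : Fin (n + 1))).comp h1

lemma pf_le (n : ℕ) : pathFiltration X n ≤ MeasurableSpace.pi := by
  have : Measurable (fun (ω : ℕ → X) (i : Fin (n + 1)) => ω (i : ℕ)) :=
    measurable_pi_lambda _ fun i => measurable_pi_apply _
  exact this.comap_le

lemma pf_mono {m n : ℕ} (h : m ≤ n) : pathFiltration X m ≤ pathFiltration X n := by
  have : Measurable[pathFiltration X n] (fun (ω : ℕ → X) (i : Fin (m + 1)) => ω (i : ℕ)) :=
    @measurable_pi_lambda _ _ _ (pathFiltration X n) _ _ fun i => pf_coord (by omega)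
  exact this.comap_le

/-- The natural filtration as a bundled filtration. -/
def filt (X : Type*) [MeasurableSpace X] : Filtration ℕ (MeasurableSpace.pi : MeasurableSpace (ℕ → X)) where
  seq := pathFiltration X
  mono' := fun _ _ h => pf_mono h
  le' := pf_le

variable (M : MarkovChain X)

lemma meas_Pr {f : X → ℝ} (hf : Measurable f) : Measurable (Pr M f) := by
  have h : StronglyMeasurable (fun η : ℕ → X => f (η 1)) :=
    (hf.comp (measurable_pi_apply 1)).stronglyMeasurable
  exact (h.integral_kernel (κ := (⟨M.law, M.meas_law⟩ : ProbabilityTheory.Kernel X (ℕ → X)))).measurable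

lemma lint_step (x : X) (k : ℕ) {A : Set (ℕ → X)} (hA : MeasurableSet[pathFiltration X k] A)
    {f : X → ℝ≥0∞} (hf : Measurable f) :
    ∫⁻ ω in A, f (ω (k + 1)) ∂M.law x = ∫⁻ ω in A, ∫⁻ η, f (η 1) ∂M.law (ω k) ∂M.law x := by
  have := M.markov x k A hA (fun η => f (η 1)) (hf.comp (measurable_pi_apply 1))
  simp only [add_comm 1 k] at this
  exact this

lemma lint_Pr {f : X → ℝ} (h0 : ∀ y, 0 ≤ f y)
    {y : X} (hi : Integrable (fun η => f (η 1)) (M.law y)) :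
    ∫⁻ η, ENNReal.ofReal (f (η 1)) ∂M.law y = ENNReal.ofReal (Pr M f y) :=
  (ofReal_integral_eq_lintegral_ofReal hi (ae_of_all _ fun _ => h0 _)).symm

lemma meas_coord {f : X → ℝ} (hf : Measurable f) (k : ℕ) : Measurable (fun ω : ℕ → X => f (ω k)) :=
  hf.comp (measurable_pi_apply k)

lemma lint_step_real (x : X) (k : ℕ) {A : Set (ℕ → X)} (hA : MeasurableSet[pathFiltration X k] A)
    {f : X → ℝ} (hf : Measurable f) (h0 : ∀ y, 0 ≤ f y)
    (hi : ∀ y, Integrable (fun η => f (η 1)) (M.law y)) :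
    ∫⁻ ω in A, ENNReal.ofReal (f (ω (k + 1))) ∂M.law x
      = ∫⁻ ω in A, ENNReal.ofReal (Pr M f (ω k)) ∂M.law x := by
  rw [M.lint_step x k hA (f := fun y => ENNReal.ofReal (f y)) hf.ennreal_ofReal]
  simp_rw [fun ω : ℕ → X => M.lint_Pr h0 (hi (ω k))]

lemma Pr_nonneg {f : X → ℝ} (h0 : ∀ y, 0 ≤ f y) (y : X) : 0 ≤ Pr M f y :=
  integral_nonneg fun _ => h0 _

/-- nonnegative case: integrability transfers. -/
lemma int_iff (x : X) (k : ℕ) {f : X → ℝ} (hf : Measurable f) (h0 : ∀ y, 0 ≤ f y)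
    (hi : ∀ y, Integrable (fun η => f (η 1)) (M.law y)) :
    Integrable (fun ω => f (ω (k + 1))) (M.law x) ↔ Integrable (fun ω => Pr M f (ω k)) (M.law x) := by
  have e := M.lint_step_real x k (A := Set.univ) MeasurableSet.univ hf h0 hi
  simp only [Measure.restrict_univ] at e
  rw [← lintegral_ofReal_ne_top_iff_integrable (meas_coord hf _).aestronglyMeasurable (ae_of_all _ fun _ => h0 _),
    ← lintegral_ofReal_ne_top_iff_integrable (meas_coord (M.meas_Pr hf) _).aestronglyMeasurable
      (ae_of_all _ fun _ => M.Pr_nonneg h0 _), e]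

lemma setInt_nonneg (x : X) (k : ℕ) {A : Set (ℕ → X)} (hA : MeasurableSet[pathFiltration X k] A)
    {f : X → ℝ} (hf : Measurable f) (h0 : ∀ y, 0 ≤ f y)
    (hi : ∀ y, Integrable (fun η => f (η 1)) (M.law y)) :
    ∫ ω in A, f (ω (k + 1)) ∂M.law x = ∫ ω in A, Pr M f (ω k) ∂M.law x := by
  rw [integral_eq_lintegral_of_nonneg_ae (ae_of_all _ fun _ => h0 _) (meas_coord hf _).aestronglyMeasurable,
    integral_eq_lintegral_of_nonneg_ae (ae_of_all _ fun _ => M.Pr_nonneg h0 _)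
      (meas_coord (M.meas_Pr hf) _).aestronglyMeasurable, M.lint_step_real x k hA hf h0 hi]

/-- the conditional expectation of `f(X_{k+1})` is `Pf(X_k)`. -/
lemma step (x : X) (k : ℕ) {f : X → ℝ} (hf : Measurable f)
    (hi : ∀ y, Integrable (fun η => f (η 1)) (M.law y))
    (hk : Integrable (fun ω => f (ω (k + 1))) (M.law x)) :
    Integrable (fun ω => Pr M f (ω k)) (M.law x) ∧
    (M.law x)[fun ω => f (ω (k + 1)) | filt X k] =ᵐ[M.law x] fun ω => Pr M f (ω k) := by
  have := M.prob x
  set fp : X → ℝ := fun y => max (f y) 0 with hfp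
  set fm : X → ℝ := fun y => max (-f y) 0 with hfm
  have mp : Measurable fp := hf.max measurable_const
  have mm : Measurable fm := hf.neg.max measurable_const
  have np : ∀ y, 0 ≤ fp y := fun y => le_max_right _ _
  have nm : ∀ y, 0 ≤ fm y := fun y => le_max_right _ _
  have ip : ∀ y, Integrable (fun η => fp (η 1)) (M.law y) := fun y => (hi y).pos_part
  have im : ∀ y, Integrable (fun η => fm (η 1)) (M.law y) := fun y => (hi y).neg_part
  have ed : ∀ y, f y = fp y - fm y := fun y => by
    simp only [hfp, hfm]
    rcases le_total 0 (f y) with h | h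
    · rw [max_eq_left h, max_eq_right (by linarith)]; ring
    · rw [max_eq_right h, max_eq_left (by linarith)]; ring
  have eP : ∀ y, Pr M f y = Pr M fp y - Pr M fm y := fun y => by
    unfold Pr; rw [← integral_sub (ip y) (im y)]; simp_rw [fun η : ℕ → X => ed (η 1)]
  have ipk : Integrable (fun ω => fp (ω (k + 1))) (M.law x) := hk.pos_part
  have imk : Integrable (fun ω => fm (ω (k + 1))) (M.law x) := hk.neg_part
  have Ip := (M.int_iff x k mp np ip).1 ipk
  have Im := (M.int_iff x k mm nm im).1 imk
  have I : Integrable (fun ω => Pr M f (ω k)) (M.law x) := by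
    simp_rw [fun ω : ℕ → X => eP (ω k)]; exact Ip.sub Im
  refine ⟨I, ?_⟩
  symm
  refine ae_eq_condExp_of_forall_setIntegral_eq ((filt X).le k) hk (fun s _ _ => I.integrableOn) ?_ ?_
  · intro s hs _
    simp_rw [fun ω : ℕ → X => eP (ω k), fun ω : ℕ → X => ed (ω (k + 1))]
    rw [integral_sub Ip.integrableOn Im.integrableOn, integral_sub ipk.integrableOn imk.integrableOn,
      M.setInt_nonneg x k hs mp np ip, M.setInt_nonneg x k hs mm nm im]
  · have : Measurable[filt X k] (fun ω : ℕ → X => Pr M f (ω k)) := (M.meas_Pr hf).comp (pf_coord le_rfl)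
    exact this.stronglyMeasurable.aestronglyMeasurable

lemma int_step (x : X) (k : ℕ) {f : X → ℝ} (hf : Measurable f) (h0 : ∀ y, 0 ≤ f y)
    (hi : ∀ y, Integrable (fun η => f (η 1)) (M.law y)) :
    ∫ ω, f (ω (k + 1)) ∂M.law x = ∫ ω, Pr M f (ω k) ∂M.law x := by
  have := M.setInt_nonneg x k (A := Set.univ) MeasurableSet.univ hf h0 hi
  simpa using this

lemma start_ae (x : X) {f : X → ℝ} (hf : Measurable f) : ∀ᵐ ω ∂M.law x, f (ω 0) = f x := by
  have h : ∀ᵐ y ∂(Measure.dirac x : Measure X), f y = f x :=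
    (ae_dirac_iff (hf (measurableSet_singleton (f x)))).2 rfl
  rw [← M.start x] at h
  exact ae_of_ae_map (measurable_pi_apply 0).aemeasurable h

section drift
variable {M} {τ : (ℕ → X) → ℕ∞} {u : X → ℝ} (hu : IsDrift M τ u)
include hu

lemma meas_w : Measurable (wE M u) := (hu.meas.sub (M.meas_Pr hu.meas)).add_const _

lemma one_le_Pu (y : X) : 1 ≤ Pr M u y := by
  have := M.prob y
  have : ∫ _ : ℕ → X, (1 : ℝ) ∂M.law y ≤ Pr M u y :=
    integral_mono (integrable_const _) (hu.int_one y) fun _ => hu.one_le _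
  simpa using this

lemma Pu_le (y : X) : Pr M u y ≤ u y + (Bu M u - 1) := by
  have := le_csSup hu.bdd (Set.mem_range_self y)
  simp only [Bu]; linarith

lemma one_le_w (y : X) : 1 ≤ wE M u y := by
  have := Pu_le hu y
  simp only [wE]; linarith

lemma w_le (y : X) : wE M u y ≤ u y + Bu M u := by
  have := one_le_Pu hu y
  simp only [wE]; linarith

lemma int_w_of {μ : Measure (ℕ → X)} [IsFiniteMeasure μ] {k : ℕ} (h : Integrable (fun ω => u (ω k)) μ) :
    Integrable (fun ω => wE M u (ω k)) μ := by
  refine (h.add (integrable_const (Bu M u))).mono' (meas_coord (meas_w hu) k).aestronglyMeasurable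
    (ae_of_all _ fun ω => ?_)
  rw [Real.norm_of_nonneg (zero_le_one.trans (one_le_w hu _))]
  exact w_le hu _

lemma int_w_one (y : X) : Integrable (fun ω => wE M u (ω 1)) (M.law y) := by
  have := M.prob y
  exact int_w_of hu (hu.int_one y)

lemma int_u (x : X) (k : ℕ) : Integrable (fun ω => u (ω k)) (M.law x) := by
  have := M.prob x
  induction k with
  | zero =>
    refine (integrable_const (u x)).congr ?_
    filter_upwards [M.start_ae x hu.meas] with ω h using h.symm
  | succ k ih =>
    rw [M.int_iff x k hu.meas (fun y => zero_le_one.trans (hu.one_le y)) hu.int_one]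
    refine (ih.add (integrable_const (Bu M u - 1))).mono' (meas_coord (M.meas_Pr hu.meas) k).aestronglyMeasurable
      (ae_of_all _ fun ω => ?_)
    rw [Real.norm_of_nonneg (zero_le_one.trans (one_le_Pu hu _))]
    exact Pu_le hu _

lemma int_w (x : X) (k : ℕ) : Integrable (fun ω => wE M u (ω k)) (M.law x) := by
  have := M.prob x
  exact int_w_of hu (int_u hu x k)

lemma sum_w (x : X) (n : ℕ) : ∑ k ∈ Finset.range n, ∫ ω, wE M u (ω k) ∂M.law x
    = u x - ∫ ω, u (ω n) ∂M.law x + n * Bu M u := by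
  have := M.prob x
  induction n with
  | zero =>
    have : ∫ ω, u (ω 0) ∂M.law x = u x := by
      rw [integral_congr_ae (M.start_ae x hu.meas)]; simp
    simp [this]
  | succ n ih =>
    have hP := (M.int_iff x n hu.meas (fun y => zero_le_one.trans (hu.one_le y)) hu.int_one).1 (int_u hu x (n + 1))
    have e : ∫ ω, wE M u (ω n) ∂M.law x = ∫ ω, u (ω n) ∂M.law x - ∫ ω, u (ω (n + 1)) ∂M.law x + Bu M u := by
      rw [M.int_step x n hu.meas (fun y => zero_le_one.trans (hu.one_le y)) hu.int_one]
      simp only [wE]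
      have hs : Integrable (fun ω => u (ω n) - Pr M u (ω n)) (M.law x) := (int_u hu x n).sub hP
      rw [integral_add hs (integrable_const _), integral_sub (int_u hu x n) hP]
      simp
    rw [Finset.sum_range_succ, ih, e]; push_cast; ring

lemma sum_w_le (x : X) (n : ℕ) : ∑ k ∈ Finset.range n, ∫ ω, wE M u (ω k) ∂M.law x
    ≤ (u x + |Bu M u|) * n := by
  rcases Nat.eq_zero_or_pos n with rfl | h
  · simp
  rw [sum_w hu]
  have h1 : (1 : ℝ) ≤ n := by exact_mod_cast h
  have h2 : 0 ≤ ∫ ω, u (ω n) ∂M.law x := integral_nonneg fun _ => zero_le_one.trans (hu.one_le _)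
  nlinarith [hu.one_le x, le_abs_self (Bu M u)]

section g
variable {p : ℝ} (hp : 2 < p) {g : X → ℝ} (hg : MemWp (wE M u) p g)
include hp hg

lemma exists_K : ∃ K : ℝ, 0 ≤ K ∧ (∀ y, |g y| ≤ K * wE M u y ^ (1 / p)) := by
  obtain ⟨_, C, hC⟩ := hg
  refine ⟨|C|, abs_nonneg _, fun y => (hC y).trans ?_⟩
  have := Real.rpow_nonneg (zero_le_one.trans (one_le_w hu y)) (1 / p)
  gcongr; exact le_abs_self C

lemma g_le : ∃ K : ℝ, 0 ≤ K ∧ (∀ y, |g y| ≤ K * wE M u y) ∧ (∀ y, g y ^ 2 ≤ K * wE M u y) := by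
  obtain ⟨K, K0, hK⟩ := exists_K hu hp hg
  have a1 : ∀ y, wE M u y ^ (1 / p) ≤ wE M u y := fun y => by
    calc _ ≤ wE M u y ^ (1 : ℝ) := Real.rpow_le_rpow_of_exponent_le (one_le_w hu y)
          (by rw [div_le_one (by linarith)]; linarith)
      _ = _ := Real.rpow_one _
  have a2 : ∀ y, (wE M u y ^ (1 / p)) ^ 2 ≤ wE M u y := fun y => by
    rw [← Real.rpow_natCast, ← Real.rpow_mul (zero_le_one.trans (one_le_w hu y))]
    calc _ ≤ wE M u y ^ (1 : ℝ) := Real.rpow_le_rpow_of_exponent_le (one_le_w hu y)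
          (by push_cast; rw [div_mul_eq_mul_div, div_le_one (by linarith)]; linarith)
      _ = _ := Real.rpow_one _
  have w0 : ∀ y, 0 ≤ wE M u y := fun y => zero_le_one.trans (one_le_w hu y)
  refine ⟨K + K ^ 2, by positivity, fun y => ?_, fun y => ?_⟩
  · calc _ ≤ K * wE M u y ^ (1 / p) := hK y
      _ ≤ K * wE M u y := by gcongr; exact a1 y
      _ ≤ _ := by nlinarith [w0 y, sq_nonneg K, mul_nonneg (sq_nonneg K) (w0 y)]
  · calc g y ^ 2 = |g y| ^ 2 := (sq_abs _).symm
      _ ≤ (K * wE M u y ^ (1 / p)) ^ 2 := by gcongr; exact hK y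
      _ = K ^ 2 * (wE M u y ^ (1 / p)) ^ 2 := by ring
      _ ≤ K ^ 2 * wE M u y := by gcongr; exact a2 y
      _ ≤ _ := by nlinarith [mul_nonneg K0 (w0 y)]

lemma int_g {μ : Measure (ℕ → X)} {k : ℕ} (h : Integrable (fun ω => wE M u (ω k)) μ) :
    Integrable (fun ω => g (ω k)) μ ∧ Integrable (fun ω => g (ω k) ^ 2) μ := by
  obtain ⟨K, K0, h1, h2⟩ := g_le hu hp hg
  refine ⟨(h.const_mul K).mono' (meas_coord hg.1 k).aestronglyMeasurable (ae_of_all _ fun ω => h1 _),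
    (h.const_mul K).mono' ((meas_coord hg.1 k).pow_const 2).aestronglyMeasurable (ae_of_all _ fun ω => ?_)⟩
  rw [Real.norm_of_nonneg (sq_nonneg _)]; exact h2 _

lemma Pg_mem : MemWp (wE M u) p (Pr M g) := by
  refine ⟨M.meas_Pr hg.1, ?_⟩
  obtain ⟨K, K0, hK⟩ := exists_K hu hp hg
  obtain ⟨C, hC⟩ := hu.pw_bdd
  have w1 := one_le_w hu
  have w0 : ∀ y, 0 < wE M u y := fun y => zero_lt_one.trans_le (one_le_w hu y)
  refine ⟨K * (1 + C), fun y => ?_⟩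
  have := M.prob y
  set a := wE M u y with ha
  have a0 : 0 < a := w0 y
  have key : ∀ z, |g z| ≤ K * a ^ (1 / p) * (1 + wE M u z / a) := fun z => by
    refine (hK z).trans ?_
    rw [mul_assoc]
    refine mul_le_mul_of_nonneg_left ?_ K0
    have e : wE M u z = a * (wE M u z / a) := by field_simp
    have b0 : 0 ≤ wE M u z / a := (div_pos (w0 z) a0).le
    conv_lhs => rw [e]
    rw [Real.mul_rpow a0.le b0]
    refine mul_le_mul_of_nonneg_left ?_ (Real.rpow_nonneg a0.le _)
    have p0 : 0 ≤ 1 / p := by positivity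
    have p1 : 1 / p ≤ 1 := by rw [div_le_one (by linarith)]; linarith
    rcases le_total (wE M u z / a) 1 with h | h
    · have := Real.rpow_le_one b0 h p0; linarith
    · calc _ ≤ (wE M u z / a) ^ (1 : ℝ) := Real.rpow_le_rpow_of_exponent_le h p1
        _ = wE M u z / a := Real.rpow_one _
        _ ≤ _ := by linarith
  have i1 : Integrable (fun η : ℕ → X => K * a ^ (1 / p) * (1 + wE M u (η 1) / a)) (M.law y) :=
    ((integrable_const 1).add ((int_w_one hu y).div_const a)).const_mul _
  calc |Pr M g y| ≤ ∫ η, |g (η 1)| ∂M.law y := abs_integral_le_integral_abs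
    _ ≤ ∫ η, K * a ^ (1 / p) * (1 + wE M u (η 1) / a) ∂M.law y :=
        integral_mono (int_g hu hp hg (int_w_one hu y)).1.abs i1 fun η => key _
    _ = K * a ^ (1 / p) * (1 + Pr M (wE M u) y / a) := by
        rw [integral_const_mul, integral_add (integrable_const 1) ((int_w_one hu y).div_const a), integral_div]
        simp [Pr]
    _ ≤ K * a ^ (1 / p) * (1 + C) := by
        have : Pr M (wE M u) y / a ≤ C := by rw [div_le_iff₀ a0]; exact hC y
        have := Real.rpow_nonneg a0.le (1 / p)
        gcongr
    _ = _ := by ring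

lemma V_nonneg (y : X) : 0 ≤ Pr M (fun z => g z ^ 2) y - Pr M g y ^ 2 := by
  have := M.prob y
  obtain ⟨i1, i2⟩ := int_g hu hp hg (int_w_one hu y)
  have h : 0 ≤ ∫ η, (g (η 1) - Pr M g y) ^ 2 ∂M.law y := integral_nonneg fun _ => sq_nonneg _
  have e : ∫ η, (g (η 1) - Pr M g y) ^ 2 ∂M.law y
      = ∫ η, (g (η 1) ^ 2 - 2 * Pr M g y * g (η 1) + Pr M g y ^ 2) ∂M.law y := by
    congr 1; ext η; ring
  have hs : Integrable (fun η : ℕ → X => g (η 1) ^ 2 - 2 * Pr M g y * g (η 1)) (M.law y) := i2.sub (i1.const_mul _)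
  rw [e, integral_add hs (integrable_const _), integral_sub i2 (i1.const_mul _),
    integral_const_mul] at h
  simp only [integral_const, probReal_univ, one_smul] at h
  have e1 : ∫ η, g (η 1) ∂M.law y = Pr M g y := rfl
  have e2 : ∫ η, g (η 1) ^ 2 ∂M.law y = Pr M (fun z => g z ^ 2) y := rfl
  rw [e1, e2] at h
  nlinarith

lemma D_pow : ∃ K : ℝ, 0 ≤ K ∧ ∀ y z, |g z - Pr M g y| ^ p ≤ K * (wE M u z + wE M u y) := by
  obtain ⟨K, K0, hK⟩ := exists_K hu hp hg
  obtain ⟨L, L0, hL⟩ := exists_K hu hp (Pg_mem hu hp hg)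
  have w0 : ∀ y, 0 ≤ wE M u y := fun y => zero_le_one.trans (one_le_w hu y)
  have p0 : 0 < p := by linarith
  refine ⟨(K + L) ^ p, by positivity, fun y z => ?_⟩
  set m := wE M u z + wE M u y with hm
  have m0 : 0 ≤ m := add_nonneg (w0 _) (w0 _)
  calc |g z - Pr M g y| ^ p ≤ ((K + L) * m ^ (1 / p)) ^ p := by
        refine Real.rpow_le_rpow (abs_nonneg _) ?_ p0.le
        have h1 : wE M u z ^ (1 / p) ≤ m ^ (1 / p) :=
          Real.rpow_le_rpow (w0 _) (by linarith [w0 y]) (by positivity)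
        have h2 : wE M u y ^ (1 / p) ≤ m ^ (1 / p) :=
          Real.rpow_le_rpow (w0 _) (by linarith [w0 z]) (by positivity)
        calc _ ≤ |g z| + |Pr M g y| := abs_sub _ _
          _ ≤ K * wE M u z ^ (1 / p) + L * wE M u y ^ (1 / p) := add_le_add (hK z) (hL y)
          _ ≤ K * m ^ (1 / p) + L * m ^ (1 / p) := by gcongr
          _ = _ := by ring
    _ = (K + L) ^ p * m := by
        rw [Real.mul_rpow (by positivity) (by positivity), ← Real.rpow_mul m0, one_div_mul_cancel p0.ne', Real.rpow_one]

lemma mda (x : X) {s : ℝ} (hs : 0 < s)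
    (hae : ∀ᵐ ω ∂M.law x, Tendsto (fun n : ℕ =>
        (∑ k ∈ Finset.range n, (Pr M (fun y => g y ^ 2) (ω k) - Pr M g (ω k) ^ 2)) / (n : ℝ))
        atTop (𝓝 s)) :
    ∃ C, MDA (M.law x) (filt X) (fun k ω => (Real.sqrt s)⁻¹ * (g (ω (k + 1)) - Pr M g (ω k)))
      (fun k ω => s⁻¹ * (Pr M (fun y => g y ^ 2) (ω k) - Pr M g (ω k) ^ 2)) p C := by
  have := M.prob x
  obtain ⟨K, K0, hK⟩ := D_pow hu hp hg
  obtain ⟨B, hB⟩ := hu.pw_bdd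
  have w1 := one_le_w hu
  have w0 : ∀ y, 0 ≤ wE M u y := fun y => zero_le_one.trans (w1 y)
  have B0 : 0 ≤ B := by
    have h1 : 0 ≤ Pr M (wE M u) x := M.Pr_nonneg w0 x
    have := h1.trans (hB x)
    exact nonneg_of_mul_nonneg_left this (zero_lt_one.trans_le (w1 x))
  have mP := M.meas_Pr hg.1
  have mP2 := M.meas_Pr (f := fun y => g y ^ 2) (hg.1.pow_const 2)
  have hPg := Pg_mem hu hp hg
  set c := (Real.sqrt s)⁻¹ with hc
  have c0 : 0 < c := inv_pos.2 (Real.sqrt_pos.2 hs)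
  have cc : c ^ 2 = s⁻¹ := by rw [hc, inv_pow, Real.sq_sqrt hs.le]
  have mD : ∀ k, Measurable (fun ω : ℕ → X => c * (g (ω (k + 1)) - Pr M g (ω k))) := fun k =>
    ((meas_coord hg.1 (k + 1)).sub (meas_coord mP k)).const_mul c
  have bd : ∀ k, ∀ ω : ℕ → X, |c * (g (ω (k + 1)) - Pr M g (ω k))| ^ p
      ≤ c ^ p * K * (wE M u (ω (k + 1)) + wE M u (ω k)) := fun k ω => by
    rw [abs_mul, abs_of_pos c0, Real.mul_rpow c0.le (abs_nonneg _), mul_assoc]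
    exact mul_le_mul_of_nonneg_left (hK _ _) (by positivity)
  have iw : ∀ k, Integrable (fun ω => c ^ p * K * (wE M u (ω (k + 1)) + wE M u (ω k))) (M.law x) := fun k =>
    ((int_w hu x (k + 1)).add (int_w hu x k)).const_mul _
  have iD : ∀ k, Integrable (fun ω : ℕ → X => |c * (g (ω (k + 1)) - Pr M g (ω k))| ^ p) (M.law x) := fun k =>
    (iw k).mono' ((mD k).abs.pow_const p).aestronglyMeasurable (ae_of_all _ fun ω => by
      rw [Real.norm_of_nonneg (by positivity)]; exact bd k ω)
  have ig := fun k => int_g hu hp hg (int_w hu x (k + 1))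
  have iP := fun k => int_g hu hp hPg (int_w hu x k)
  have st1 := fun k => M.step x k hg.1 (fun y => (int_g hu hp hg (int_w_one hu y)).1) (ig k).1
  have st2 := fun k => M.step x k (f := fun y => g y ^ 2) (hg.1.pow_const 2)
    (fun y => (int_g hu hp hg (int_w_one hu y)).2) (ig k).2
  have sP : ∀ k, StronglyMeasurable[filt X k] (fun ω : ℕ → X => Pr M g (ω k)) := fun k => by
    have : Measurable[filt X k] (fun ω : ℕ → X => Pr M g (ω k)) := mP.comp (pf_coord le_rfl)
    exact this.stronglyMeasurable
  refine ⟨c ^ p * K * (B + 1) * (u x + |Bu M u|), ⟨fun k => ?_, iD, fun n => ?_, fun k => ?_, fun k => ?_, ?_⟩⟩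
  · have h1 : Measurable[filt X (k + 1)] (fun ω : ℕ → X => g (ω (k + 1))) := hg.1.comp (pf_coord le_rfl)
    have h2 : Measurable[filt X (k + 1)] (fun ω : ℕ → X => Pr M g (ω k)) := mP.comp (pf_coord (Nat.le_succ k))
    exact ((h1.sub h2).const_mul c).stronglyMeasurable
  · calc _ ≤ ∑ k ∈ Finset.range n, c ^ p * K * (B + 1) * ∫ ω, wE M u (ω k) ∂M.law x := by
          refine Finset.sum_le_sum fun k _ => ?_
          calc _ ≤ ∫ ω, c ^ p * K * (wE M u (ω (k + 1)) + wE M u (ω k)) ∂M.law x :=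
                integral_mono (iD k) (iw k) (bd k)
            _ = c ^ p * K * (∫ ω, Pr M (wE M u) (ω k) ∂M.law x + ∫ ω, wE M u (ω k) ∂M.law x) := by
                rw [integral_const_mul, integral_add (int_w hu x (k + 1)) (int_w hu x k),
                  M.int_step x k (meas_w hu) w0 (int_w_one hu)]
            _ ≤ c ^ p * K * (B * ∫ ω, wE M u (ω k) ∂M.law x + ∫ ω, wE M u (ω k) ∂M.law x) := by
                have : ∫ ω, Pr M (wE M u) (ω k) ∂M.law x ≤ B * ∫ ω, wE M u (ω k) ∂M.law x := by
                  rw [← integral_const_mul]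
                  exact integral_mono ((M.int_iff x k (meas_w hu) w0 (int_w_one hu)).1 (int_w hu x (k + 1)))
                    ((int_w hu x k).const_mul B) fun ω => hB _
                gcongr
            _ = _ := by ring
      _ = c ^ p * K * (B + 1) * ∑ k ∈ Finset.range n, ∫ ω, wE M u (ω k) ∂M.law x := (Finset.mul_sum _ _ _).symm
      _ ≤ c ^ p * K * (B + 1) * ((u x + |Bu M u|) * n) :=
          mul_le_mul_of_nonneg_left (sum_w_le hu x n) (by positivity)
      _ = _ := by ring
  · have e : (fun ω : ℕ → X => c * (g (ω (k + 1)) - Pr M g (ω k)))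
        = c • ((fun ω : ℕ → X => g (ω (k + 1))) - fun ω => Pr M g (ω k)) := by ext ω; simp
    rw [e]
    refine (condExp_smul c _ _).trans ?_
    filter_upwards [condExp_sub (ig k).1 (iP k).1 (filt X k), (st1 k).2] with ω h1 h2
    have h3 := congrFun (condExp_of_stronglyMeasurable ((filt X).le k) (sP k) (iP k).1) ω
    rw [Pi.smul_apply, h1, Pi.sub_apply, h2, h3]; simp
  · set G : (ℕ → X) → ℝ := fun ω => g (ω (k + 1)) with hG
    set Q : (ℕ → X) → ℝ := fun ω => Pr M g (ω k) with hQ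
    have iQG : Integrable (Q * G) (M.law x) := by
      refine ((iP k).2.add (ig k).2).mono' ((meas_coord mP k).mul (meas_coord hg.1 (k + 1))).aestronglyMeasurable
        (ae_of_all _ fun ω => ?_)
      simp only [Pi.mul_apply, Pi.add_apply, Real.norm_eq_abs, hG, hQ]
      rw [abs_le]
      constructor <;> nlinarith [sq_nonneg (Pr M g (ω k) + g (ω (k + 1))), sq_nonneg (Pr M g (ω k) - g (ω (k + 1))),
        sq_nonneg (Pr M g (ω k)), sq_nonneg (g (ω (k + 1)))]
    have e : (fun ω : ℕ → X => (c * (g (ω (k + 1)) - Pr M g (ω k))) ^ 2)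
        = s⁻¹ • (((fun ω : ℕ → X => g (ω (k + 1)) ^ 2) - (2 : ℝ) • (Q * G)) + fun ω => Pr M g (ω k) ^ 2) := by
      ext ω
      simp only [Pi.smul_apply, Pi.add_apply, Pi.sub_apply, Pi.mul_apply, smul_eq_mul, hG, hQ, ← cc]; ring
    rw [e]
    refine (condExp_smul s⁻¹ _ _).trans ?_
    have sQ2 : StronglyMeasurable[filt X k] (fun ω : ℕ → X => Pr M g (ω k) ^ 2) := (sP k).pow 2
    filter_upwards [condExp_add ((ig k).2.sub (iQG.smul (2 : ℝ))) (iP k).2 (filt X k),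
      condExp_sub (ig k).2 (iQG.smul (2 : ℝ)) (filt X k), condExp_smul (2 : ℝ) (Q * G) (filt X k) (μ := M.law x),
      condExp_mul_of_stronglyMeasurable_left (sP k) iQG (ig k).1, (st1 k).2, (st2 k).2] with ω h1 h2 h3 h4 h5 h6
    have h7 := congrFun (condExp_of_stronglyMeasurable ((filt X).le k) sQ2 (iP k).2) ω
    rw [Pi.smul_apply, h1, Pi.add_apply, h2, Pi.sub_apply, h3, Pi.smul_apply, h4, Pi.mul_apply, h5, h6, h7]
    simp only [smul_eq_mul]; ring
  · filter_upwards [hae] with ω h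
    have := h.const_mul s⁻¹
    rw [inv_mul_cancel₀ hs.ne'] at this
    refine this.congr fun n => ?_
    rw [← Finset.mul_sum, mul_div_assoc]

end g
end drift
end MarkovChain

/-- Corollary 3.5 (CLT and LIL for martingales): for a drift function `u`, `α > 0`,
`g ∈ 𝓔^{2+α}_u` and `x`, if `(1/n) ∑_{k<n} (P(g²)(X_k) - (Pg(X_k))²)` converges a.e. and
in `L¹(ℙ_x)` to some `σ² ≠ 0`, then `(1/√n) ∑_{k<n} (g(X_{k+1}) - Pg(X_k))` converges in
law to `𝓝(0,σ²)` and the law of the iterated logarithm holds. -/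
theorem stmt14 (M : MarkovChain X) (τ : (ℕ → X) → ℕ∞)
    (hst : IsPathStoppingTime τ) (hθ : ThetaCompatible M τ)
    (u : X → ℝ) (hu : IsDrift M τ u) (α : ℝ) (hα : 0 < α)
    (g : X → ℝ) (hg : MemWp (wE M u) (2 + α) g) (x : X)
    (σ2 : ℝ) (hσ2 : σ2 ≠ 0)
    (hae : ∀ᵐ ω ∂M.law x, Tendsto (fun n : ℕ =>
        (∑ k ∈ Finset.range n, (Pr M (fun y => g y ^ 2) (ω k) - Pr M g (ω k) ^ 2)) / (n : ℝ))
        atTop (𝓝 σ2))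
    (hL1 : Tendsto (fun n : ℕ => ∫ ω,
        |(∑ k ∈ Finset.range n, (Pr M (fun y => g y ^ 2) (ω k) - Pr M g (ω k) ^ 2)) / (n : ℝ)
          - σ2| ∂M.law x)
        atTop (𝓝 0)) :
    (∀ F : BoundedContinuousFunction ℝ ℝ,
        Tendsto (fun n : ℕ => ∫ ω,
            F ((∑ k ∈ Finset.range n, (g (ω (k + 1)) - Pr M g (ω k))) / Real.sqrt n)
              ∂M.law x)
          atTop (𝓝 (∫ z, F z ∂(ProbabilityTheory.gaussianReal 0 σ2.toNNReal)))) ∧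
    (∀ᵐ ω ∂M.law x,
        limsup (fun n : ℕ => (∑ k ∈ Finset.range n, (g (ω (k + 1)) - Pr M g (ω k))) /
            Real.sqrt (2 * n * σ2 * Real.log (Real.log n))) atTop = 1 ∧
        liminf (fun n : ℕ => (∑ k ∈ Finset.range n, (g (ω (k + 1)) - Pr M g (ω k))) /
            Real.sqrt (2 * n * σ2 * Real.log (Real.log n))) atTop = -1) := by
  have hp : (2 : ℝ) < 2 + α := by linarith
  have hprob := M.prob x
  have hs0 : 0 ≤ σ2 := by
    obtain ⟨ω, h⟩ := hae.exists
    exact ge_of_tendsto' h fun n => div_nonneg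
      (Finset.sum_nonneg fun k _ => MarkovChain.V_nonneg hu hp hg (ω k)) (Nat.cast_nonneg n)
  have hs : 0 < σ2 := lt_of_le_of_ne hs0 (Ne.symm hσ2)
  have hq : 0 < Real.sqrt σ2 := Real.sqrt_pos.2 hs
  obtain ⟨C, hM⟩ := MarkovChain.mda hu hp hg x hs hae
  refine ⟨fun F => ?_, ?_⟩
  · have := hM.clt_weak hp hs F
    simp only [mul_inv_cancel_left₀ hq.ne'] at this
    exact this
  · filter_upwards [hM.lil hp] with ω h
    have e : ∀ n : ℕ, (∑ k ∈ Finset.range n, (g (ω (k + 1)) - Pr M g (ω k))) /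
            Real.sqrt (2 * n * σ2 * Real.log (Real.log n))
        = (∑ k ∈ Finset.range n, (Real.sqrt σ2)⁻¹ * (g (ω (k + 1)) - Pr M g (ω k))) / LL n := fun n => by
      have : Real.sqrt (2 * n * σ2 * Real.log (Real.log n)) = Real.sqrt σ2 * LL n := by
        rw [LL, ← Real.sqrt_mul hs0]; congr 1; ring
      rw [this, ← Finset.mul_sum, ← div_div, div_eq_inv_mul _ (Real.sqrt σ2)]
    simp only [e]
    exact h

end
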